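/- arXiv:1110.3549 — 9 statements merged into one kernel-verified Lean document; each statement's English description precedes it below -/
import Mathlib

section
/- Assume that every computable function has a single-fold Diophantine representation; precisely, assume that for every computable function f : ℕ → ℕ there exist an integer r ≥ 2 and a polynomial W with integer coefficients in variables x_1,…,x_r such that for all x_1, x_2 ∈ ℕ one has x_1 = f(x_2) if and only if there exist x_3,…,x_r ∈ ℕ with W(x_1,x_2,x_3,…,x_r) = 0, and moreover for each x_1, x_2 ∈ ℕ at most one tuple (x_3,…,x_r) ∈ ℕ^{r−2} satisfies W(x_1,x_2,x_3,…,x_r) = 0. Then for every computable function f : ℕ → ℕ there is a positive integer m(f) such that for each integer n ≥ m(f) there exists a system U ⊆ E_n which has exactly f(n) solutions in non-negative integers x_1,…,x_n. -/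
/-- An equation of the system `E_n`: either `x_i = 1`, or `x_i + x_j = x_k`,
or `x_i · x_j = x_k`, with indices in `{1,…,n}` (here `Fin n`). -/
inductive Eqn (n : ℕ) : Type where
  | one (i : Fin n) : Eqn n
  | add (i j k : Fin n) : Eqn n
  | mul (i j k : Fin n) : Eqn n

/-- A valuation `x : Fin n → R` satisfies an equation of `E_n`. -/
def Eqn.holds {R : Type*} [Semiring R] {n : ℕ} (x : Fin n → R) : Eqn n → Prop
  | .one i => x i = 1
  | .add i j k => x i + x j = x k
  | .mul i j k => x i * x j = x k

open MvPolynomial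

/-- `t` respects every instance of `1`, `p + q` and `p * q` available inside `S`. -/
def RespectsOps {σ : Type} (S : Finset (MvPolynomial σ ℕ)) (t : MvPolynomial σ ℕ → ℕ) : Prop :=
  (1 ∈ S → t 1 = 1) ∧
    ∀ p ∈ S, ∀ q ∈ S, (p + q ∈ S → t p + t q = t (p + q)) ∧ (p * q ∈ S → t p * t q = t (p * q))

/-- On `S`, the only maps respecting the operations are evaluations. -/
def EvalDetermined {σ : Type} (S : Finset (MvPolynomial σ ℕ)) : Prop :=
  ∀ t, RespectsOps S t → ∀ p ∈ S, t p = eval (fun i => t (X i)) p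

theorem RespectsOps.mono {σ : Type} {S T : Finset (MvPolynomial σ ℕ)} (h : S ⊆ T)
    {t : MvPolynomial σ ℕ → ℕ} (ht : RespectsOps T t) : RespectsOps S t :=
  ⟨fun h1 => ht.1 (h h1), fun p hp q hq =>
    ⟨fun hs => (ht.2 p (h hp) q (h hq)).1 (h hs), fun hs => (ht.2 p (h hp) q (h hq)).2 (h hs)⟩⟩

namespace EvalDetermined

variable {σ : Type} {S T : Finset (MvPolynomial σ ℕ)} {p q : MvPolynomial σ ℕ}

theorem empty : EvalDetermined (∅ : Finset (MvPolynomial σ ℕ)) := by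
  intro t _ p hp
  simp at hp

theorem singleton_zero : EvalDetermined ({0} : Finset (MvPolynomial σ ℕ)) := by
  intro t ht p hp
  obtain rfl := Finset.mem_singleton.1 hp
  have := (ht.2 0 hp 0 hp).1 (by simp)
  simp at this ⊢
  exact this

theorem singleton_one : EvalDetermined ({1} : Finset (MvPolynomial σ ℕ)) := by
  intro t ht p hp
  obtain rfl := Finset.mem_singleton.1 hp
  simpa using ht.1 hp

theorem singleton_X (i : σ) : EvalDetermined ({X i} : Finset (MvPolynomial σ ℕ)) := by
  intro t ht p hp
  obtain rfl := Finset.mem_singleton.1 hp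
  simp

variable [DecidableEq σ]

theorem union (hS : EvalDetermined S) (hT : EvalDetermined T) : EvalDetermined (S ∪ T) := by
  intro t ht p hp
  rcases Finset.mem_union.1 hp with h | h
  · exact hS t (ht.mono Finset.subset_union_left) p h
  · exact hT t (ht.mono Finset.subset_union_right) p h

theorem insert_add (hS : EvalDetermined S) (hp : p ∈ S) (hq : q ∈ S) :
    EvalDetermined (insert (p + q) S) := by
  intro t ht r hr
  have h := hS t (ht.mono (Finset.subset_insert _ _))
  rcases Finset.mem_insert.1 hr with rfl | hr
  · rw [← (ht.2 p (by simp [hp]) q (by simp [hq])).1 (by simp), h p hp, h q hq, map_add]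
  · exact h r hr

theorem insert_mul (hS : EvalDetermined S) (hp : p ∈ S) (hq : q ∈ S) :
    EvalDetermined (insert (p * q) S) := by
  intro t ht r hr
  have h := hS t (ht.mono (Finset.subset_insert _ _))
  rcases Finset.mem_insert.1 hr with rfl | hr
  · rw [← (ht.2 p (by simp [hp]) q (by simp [hq])).2 (by simp), h p hp, h q hq, map_mul]
  · exact h r hr

/-- Adjoining an initial segment of the constants. -/
theorem union_constants (hS : EvalDetermined S) (h0 : 0 ∈ S) (h1 : 1 ∈ S) (m : ℕ) :
    EvalDetermined (S ∪ (Finset.range m).image (C : ℕ → MvPolynomial σ ℕ)) := by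
  induction m with
  | zero => simpa using hS
  | succ m ih =>
    rw [Finset.range_add_one, Finset.image_insert, Finset.union_insert]
    rcases m with _ | m
    · simpa [h0] using hS
    · rw [C_add, C_1]
      exact ih.insert_add (by simp) (by simp [h1])

theorem exists_mem (p : MvPolynomial σ ℕ) : ∃ S, EvalDetermined S ∧ p ∈ S := by
  induction p using MvPolynomial.induction_on with
  | C a =>
    refine ⟨_, (singleton_zero.union singleton_one).union_constants (by simp) (by simp) (a + 1), ?_⟩
    simp
  | add p q hp hq =>
    obtain ⟨S, hS, hp⟩ := hp
    obtain ⟨T, hT, hq⟩ := hq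
    exact ⟨_, (hS.union hT).insert_add (Finset.mem_union_left _ hp) (Finset.mem_union_right _ hq),
      Finset.mem_insert_self _ _⟩
  | mul_X p i hp =>
    obtain ⟨S, hS, hp⟩ := hp
    exact ⟨_, (hS.union (singleton_X i)).insert_mul (Finset.mem_union_left _ hp)
      (Finset.mem_union_right _ (Finset.mem_singleton_self _)), Finset.mem_insert_self _ _⟩

theorem exists_superset (F : Finset (MvPolynomial σ ℕ)) : ∃ S, EvalDetermined S ∧ F ⊆ S := by
  induction F using Finset.induction_on with
  | empty => exact ⟨∅, empty, subset_rfl⟩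
  | insert p F _ ih =>
    obtain ⟨S, hS, hF⟩ := ih
    obtain ⟨T, hT, hp⟩ := exists_mem p
    refine ⟨_, hS.union hT, Finset.insert_subset (Finset.mem_union_right _ hp) ?_⟩
    exact hF.trans Finset.subset_union_left

/-- A set `S` of `n` polynomials determined by evaluation turns additive constraints between the
values of its members into a system in `n` unknowns with the same number of solutions. -/
theorem exists_system {n : ℕ} (hS : EvalDetermined S) (hcard : S.card = n)
    (hX : ∀ i, X i ∈ S) (V : Set (S × S × S)) :
    ∃ U : Set (Eqn n), ∃ φ : (σ → ℕ) → (Fin n → ℕ), Function.Injective φ ∧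
      {x : Fin n → ℕ | ∀ e ∈ U, e.holds x} =
        φ '' {s | ∀ c ∈ V, eval s c.1.1 + eval s c.2.1.1 = eval s c.2.2.1} := by
  let e : S ≃ Fin n := S.equivFinOfCardEq hcard
  let U : Set (Eqn n) :=
    {E | (∃ p : S, p.1 = 1 ∧ E = .one (e p)) ∨
      (∃ p q r : S, (p.1 + q.1 = r.1 ∨ (p, q, r) ∈ V) ∧ E = .add (e p) (e q) (e r)) ∨
      (∃ p q r : S, p.1 * q.1 = r.1 ∧ E = .mul (e p) (e q) (e r))}
  refine ⟨U, fun s i => eval s (e.symm i).1, ?_, ?_⟩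
  · intro s s' h
    funext i
    simpa using congrFun h (e ⟨X i, hX i⟩)
  · ext x
    constructor
    · intro hx
      let t : MvPolynomial σ ℕ → ℕ := fun p => if h : p ∈ S then x (e ⟨p, h⟩) else 0
      have ht : ∀ p : S, t p.1 = x (e p) := fun p => by simp [t]
      have hresp : RespectsOps S t := by
        refine ⟨fun h1 => ?_, fun p hp q hq => ⟨fun hs => ?_, fun hs => ?_⟩⟩
        · exact (ht ⟨1, h1⟩).trans (hx (.one (e ⟨1, h1⟩)) (Or.inl ⟨_, rfl, rfl⟩))
        · have := hx (.add (e ⟨p, hp⟩) (e ⟨q, hq⟩) (e ⟨p + q, hs⟩))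
            (Or.inr (Or.inl ⟨_, _, _, Or.inl rfl, rfl⟩))
          simpa only [Eqn.holds, ← ht] using this
        · have := hx (.mul (e ⟨p, hp⟩) (e ⟨q, hq⟩) (e ⟨p * q, hs⟩))
            (Or.inr (Or.inr ⟨_, _, _, rfl, rfl⟩))
          simpa only [Eqn.holds, ← ht] using this
      have heval := hS t hresp
      refine ⟨fun i => t (X i), ?_, ?_⟩
      · rintro ⟨p, q, r⟩ hc
        have := hx (.add (e p) (e q) (e r)) (Or.inr (Or.inl ⟨p, q, r, Or.inr hc, rfl⟩))
        simpa only [Eqn.holds, ← ht, heval _ p.2, heval _ q.2, heval _ r.2] using this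
      · funext i
        simp only
        rw [← heval _ (e.symm i).2, ht, e.apply_symm_apply]
    · rintro ⟨s, hs, rfl⟩ E (⟨p, hp, rfl⟩ | ⟨p, q, r, h | h, rfl⟩ | ⟨p, q, r, h, rfl⟩)
      · simp [Eqn.holds, hp]
      · simp [Eqn.holds, ← h]
      · simpa [Eqn.holds] using hs _ h
      · simp [Eqn.holds, ← h]

/-- Constants can be adjoined so as to reach any prescribed large cardinality `n`, with the
constants `0, …, n - n / 2` among the members. -/
theorem exists_card_eq (hS : EvalDetermined S) (h0 : 0 ∈ S) (h1 : 1 ∈ S) {n : ℕ}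
    (hn : 2 * S.card + 4 ≤ n) :
    ∃ T, EvalDetermined T ∧ T.card = n ∧ S ⊆ T ∧ ∀ a ≤ n - n / 2, C a ∈ T := by
  let T : ℕ → Finset (MvPolynomial σ ℕ) := fun m => S ∪ (Finset.range m).image C
  have hle : ∀ m, (T m).card ≤ S.card + m := fun m =>
    (Finset.card_union_le _ _).trans
      (Nat.add_le_add_left (Finset.card_image_le.trans (Finset.card_range m).le) _)
  have hex : ∃ m, n ≤ (T m).card := by
    refine ⟨n, le_trans (le_of_eq ?_) (Finset.card_le_card Finset.subset_union_right)⟩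
    rw [Finset.card_image_of_injective _ (C_injective σ ℕ), Finset.card_range]
  have hmin : (T (Nat.find hex)).card = n := by
    refine le_antisymm ?_ (Nat.find_spec hex)
    rcases hm : Nat.find hex with _ | m
    · have := hle 0
      omega
    · have hlt : (T m).card < n := not_le.1 (Nat.find_min hex (by omega))
      have hsucc : T (m + 1) = insert (C m) (T m) := by
        simp only [T, Finset.range_add_one, Finset.image_insert, Finset.union_insert]
      have := Finset.card_insert_le (C m) (T m)
      rw [hsucc]
      omega
  have hbig := hle (Nat.find hex)
  refine ⟨_, hS.union_constants h0 h1 (Nat.find hex), hmin, Finset.subset_union_left,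
    fun a ha => Finset.mem_union_right _ (Finset.mem_image_of_mem _ (Finset.mem_range.2 ?_))⟩
  omega

end EvalDetermined

/-- An integer polynomial is, on natural arguments, a difference of two natural ones. -/
theorem exists_nat_polynomials_sub {σ : Type} (W : MvPolynomial σ ℤ) :
    ∃ P Q : MvPolynomial σ ℕ, ∀ v : σ → ℕ,
      eval (fun i => (v i : ℤ)) W = (eval v P : ℤ) - (eval v Q : ℤ) := by
  induction W using MvPolynomial.induction_on with
  | C a =>
    refine ⟨C a.toNat, C (-a).toNat, fun v => ?_⟩
    simp only [eval_C]
    omega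
  | add p q hp hq =>
    obtain ⟨P, Q, h⟩ := hp
    obtain ⟨P', Q', h'⟩ := hq
    refine ⟨P + P', Q + Q', fun v => ?_⟩
    simp only [map_add, h, h']
    push_cast
    ring
  | mul_X p i hp =>
    obtain ⟨P, Q, h⟩ := hp
    refine ⟨P * X i, Q * X i, fun v => ?_⟩
    simp only [map_mul, h, eval_X]
    push_cast
    ring

/-- Assuming Matiyasevich's conjecture on single-fold Diophantine representations
(for graphs of computable functions), for every computable `f : ℕ → ℕ` there is a
positive integer `m` such that for every `n ≥ m` some system `U ⊆ E_n` has exactly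
`f n` solutions in non-negative integers `x_1,…,x_n`. -/
theorem small_systems_prescribed_solutions
    (hMat : ∀ f : ℕ → ℕ, Computable f →
      ∃ r : ℕ, ∃ hr : 2 ≤ r, ∃ W : MvPolynomial (Fin r) ℤ,
        (∀ x1 x2 : ℕ,
          x1 = f x2 ↔ ∃ v : Fin r → ℕ, v ⟨0, by omega⟩ = x1 ∧ v ⟨1, by omega⟩ = x2 ∧
            MvPolynomial.eval (fun i => (v i : ℤ)) W = 0) ∧
        (∀ v w : Fin r → ℕ,
          v ⟨0, by omega⟩ = w ⟨0, by omega⟩ → v ⟨1, by omega⟩ = w ⟨1, by omega⟩ →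
          MvPolynomial.eval (fun i => (v i : ℤ)) W = 0 →
          MvPolynomial.eval (fun i => (w i : ℤ)) W = 0 → v = w)) :
    ∀ f : ℕ → ℕ, Computable f →
      ∃ m : ℕ, 0 < m ∧ ∀ n : ℕ, m ≤ n →
        ∃ U : Set (Eqn n),
          {x : Fin n → ℕ | ∀ e ∈ U, e.holds x}.Finite ∧
          {x : Fin n → ℕ | ∀ e ∈ U, e.holds x}.ncard = f n := by
  intro f hf
  obtain ⟨r, hr, W, hW, huniq⟩ := hMat f hf
  obtain ⟨P, Q, hPQ⟩ := exists_nat_polynomials_sub W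
  let P' : MvPolynomial (Fin r ⊕ Bool) ℕ := rename Sum.inl P
  let Q' : MvPolynomial (Fin r ⊕ Bool) ℕ := rename Sum.inl Q
  let D : MvPolynomial (Fin r ⊕ Bool) ℕ := X (Sum.inr true) + X (Sum.inr false)
  obtain ⟨S, hS, hF⟩ :=
    EvalDetermined.exists_superset ({0, 1, P', Q', D} ∪ Finset.univ.image X)
  have h0 : 0 ∈ S := hF (by simp)
  have h1 : 1 ∈ S := hF (by simp)
  refine ⟨2 * S.card + 4, by omega, fun n hn => ?_⟩
  obtain ⟨T, hT, hcard, hST, hC⟩ := hS.exists_card_eq h0 h1 hn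
  have hX : ∀ i, X i ∈ T := fun i => hST (hF (by simp))
  have hP' : P' ∈ T := hST (hF (by simp))
  have hQ' : Q' ∈ T := hST (hF (by simp))
  have hD : D ∈ T := hST (hF (by simp))
  obtain ⟨U, φ, hφ, hU⟩ := hT.exists_system hcard hX
    {(⟨P', hP'⟩, ⟨0, hST h0⟩, ⟨Q', hQ'⟩),
      (⟨C (n / 2), hC _ (by omega)⟩, ⟨C (n - n / 2), hC _ le_rfl⟩,
        ⟨X (Sum.inl ⟨1, by omega⟩), hX _⟩),
      (⟨D, hD⟩, ⟨1, hST h1⟩, ⟨X (Sum.inl ⟨0, by omega⟩), hX _⟩)}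
  refine ⟨U, ?_⟩
  obtain ⟨v, hv0, hv1, hv⟩ := (hW (f n) n).1 rfl
  let ψ : ℕ → (Fin r ⊕ Bool → ℕ) := fun u =>
    Sum.elim v (fun b => if b then u else f n - 1 - u)
  have hψ : Function.Injective ψ := fun a b h => by
    simpa [ψ] using congrFun h (Sum.inr true)
  have hzero : ∀ w : Fin r → ℕ,
      eval (fun i => (w i : ℤ)) W = 0 ↔ eval w P = eval w Q := fun w => by
    rw [hPQ, sub_eq_zero, Nat.cast_inj]
  have hsol : ∀ s : Fin r ⊕ Bool → ℕ,
      (eval (s ∘ Sum.inl) P = eval (s ∘ Sum.inl) Q ∧ n = s (Sum.inl ⟨1, by omega⟩) ∧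
        s (Sum.inr true) + s (Sum.inr false) + 1 = s (Sum.inl ⟨0, by omega⟩)) ↔
      s ∈ ψ '' (Finset.range (f n) : Set ℕ) := by
    intro s
    constructor
    · rintro ⟨hE, hn1, hsum⟩
      have hs0 : s (Sum.inl ⟨0, by omega⟩) = f n :=
        (hW _ n).2 ⟨s ∘ Sum.inl, rfl, hn1.symm, (hzero _).2 hE⟩
      have hsv : s ∘ Sum.inl = v :=
        huniq _ _ (hs0.trans hv0.symm) (hn1.symm.trans hv1.symm) ((hzero _).2 hE) hv
      refine ⟨s (Sum.inr true), by simp; omega, ?_⟩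
      funext i
      rcases i with i | _ | _
      · exact (congrFun hsv i).symm
      · simp [ψ]
        omega
      · simp [ψ]
    · rintro ⟨u, hu, rfl⟩
      have hu : u < f n := by simpa using hu
      refine ⟨(hzero v).1 hv, hv1.symm, ?_⟩
      simp only [ψ, Sum.elim_inl, Sum.elim_inr, hv0]
      simp
      omega
  have hset : {x : Fin n → ℕ | ∀ e ∈ U, e.holds x} =
      φ '' (ψ '' (Finset.range (f n) : Set ℕ)) := by
    rw [hU]
    congr 1
    ext s
    rw [← hsol s]
    have hhalf : n / 2 + (n - n / 2) = n := by omega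
    simp [P', Q', D, eval_rename, hhalf]
  rw [hset]
  refine ⟨((Finset.finite_toSet _).image _).image _, ?_⟩
  rw [Set.ncard_image_of_injective _ hφ, Set.ncard_image_of_injective _ hψ,
    Set.ncard_coe_finset, Finset.card_range]
end

section
/- For every nonzero polynomial D(x_1,…,x_p) with integer coefficients in p variables, there exist an integer n ≥ p and a system S ⊆ E_n such that: (1) for all x_1,…,x_p ∈ ℕ, D(x_1,…,x_p) = 0 if and only if there exist x_{p+1},…,x_n ∈ ℕ such that (x_1,…,x_p,x_{p+1},…,x_n) solves S; (2) for each x_1,…,x_p ∈ ℕ with D(x_1,…,x_p) = 0 the tuple (x_{p+1},…,x_n) ∈ ℕ^{n−p} making (x_1,…,x_n) a solution of S is unique. Consequently, the set of solutions of D(x_1,…,x_p) = 0 in non-negative integers x_1,…,x_p is equinumerous with the set of solutions of S in non-negative integers x_1,…,x_n. -/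
/-- Rename the variables of an equation. -/
def Eqn.map {m n : ℕ} (f : Fin m → Fin n) : Eqn m → Eqn n
  | .one i => .one (f i)
  | .add i j k => .add (f i) (f j) (f k)
  | .mul i j k => .mul (f i) (f j) (f k)

theorem Eqn.holds_map {R : Type*} [Semiring R] {m n : ℕ} (f : Fin m → Fin n) (v : Fin n → R)
    (e : Eqn m) : (e.map f).holds v ↔ e.holds (v ∘ f) := by
  cases e <;> rfl

/-- The solutions of `S` in `ℕ` are exactly the tuples `F x`, where `F x` extends `x`. -/
def Parametrizes {p n : ℕ} (hpn : p ≤ n) (S : Set (Eqn n)) (F : (Fin p → ℕ) → Fin n → ℕ) :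
    Prop :=
  (∀ x i, F x (Fin.castLE hpn i) = x i) ∧ ∀ v, (∀ e ∈ S, e.holds v) ↔ ∃ x, F x = v

/-- A variable whose value is determined by one further equation can be adjoined. -/
theorem Parametrizes.snoc {p n : ℕ} {hpn : p ≤ n} {S : Set (Eqn n)}
    {F : (Fin p → ℕ) → Fin n → ℕ} (h : Parametrizes hpn S F) (g : (Fin p → ℕ) → ℕ)
    (e : Eqn (n + 1))
    (he : ∀ x a, e.holds (Fin.snoc (F x) a : Fin (n + 1) → ℕ) ↔ a = g x) :
    Parametrizes (hpn.trans n.le_succ) (insert e (Eqn.map Fin.castSucc '' S))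
      (fun x => Fin.snoc (F x) (g x)) := by
  refine ⟨fun x i => ?_, fun v => ?_⟩
  · rw [← h.1 x i]
    exact Fin.snoc_castSucc (α := fun _ => ℕ) (g x) (F x) (Fin.castLE hpn i)
  · have hS : (∀ e' ∈ Eqn.map Fin.castSucc '' S, e'.holds v) ↔ ∃ x, F x = v ∘ Fin.castSucc := by
      rw [← h.2, Set.forall_mem_image]
      simp only [Eqn.holds_map]
    rw [Set.forall_mem_insert, hS]
    constructor
    · rintro ⟨hv, x, hx⟩
      have hsnoc : (Fin.snoc (F x) (v (Fin.last n)) : Fin (n + 1) → ℕ) = v := by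
        rw [hx]
        exact Fin.snoc_init_self v
      refine ⟨x, ?_⟩
      rw [← hsnoc, he] at hv
      simpa only [← hv] using hsnoc
    · rintro ⟨x, rfl⟩
      exact ⟨(he x _).2 rfl, x, by ext i; simp⟩

/-- Any parametrized system can be enlarged so that one of its variables takes the value `f x`. -/
def Expressible {p : ℕ} (f : (Fin p → ℕ) → ℕ) : Prop :=
  ∀ (n : ℕ) (hpn : p ≤ n) (S : Set (Eqn n)) (F : (Fin p → ℕ) → Fin n → ℕ),
    Parametrizes hpn S F →
    ∃ (m : ℕ) (hpm : p ≤ m) (T : Set (Eqn m)) (G : (Fin p → ℕ) → Fin m → ℕ),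
      Parametrizes hpm T G ∧ (∀ i, ∃ j, ∀ x, G x j = F x i) ∧ ∃ k, ∀ x, G x k = f x

namespace Expressible

variable {p : ℕ} {f g : (Fin p → ℕ) → ℕ}

theorem of_eqn (h : ∀ (n : ℕ) (hpn : p ≤ n) (S : Set (Eqn n)) (F : (Fin p → ℕ) → Fin n → ℕ),
    Parametrizes hpn S F → ∃ e : Eqn (n + 1),
      ∀ x a, e.holds (Fin.snoc (F x) a : Fin (n + 1) → ℕ) ↔ a = f x) : Expressible f := by
  intro n hpn S F hF
  obtain ⟨e, he⟩ := h n hpn S F hF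
  exact ⟨_, _, _, _, hF.snoc f e he, fun i => ⟨i.castSucc, fun x => by simp⟩,
    Fin.last n, fun x => by simp⟩

theorem proj (i : Fin p) : Expressible fun x => x i := fun n hpn S F hF =>
  ⟨n, hpn, S, F, hF, fun j => ⟨j, fun _ => rfl⟩, Fin.castLE hpn i, fun x => hF.1 x i⟩

theorem zero : Expressible fun _ : Fin p → ℕ => 0 :=
  of_eqn fun n _ _ _ _ => ⟨.add (Fin.last n) (Fin.last n) (Fin.last n), fun x a => by
    simp [Eqn.holds]⟩

theorem one : Expressible fun _ : Fin p → ℕ => 1 :=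
  of_eqn fun n _ _ _ _ => ⟨.one (Fin.last n), fun x a => by simp [Eqn.holds]⟩

/-- Two expressible functions can be made values of variables of the same system. -/
theorem exists_pair (hf : Expressible f) (hg : Expressible g) {n : ℕ} {hpn : p ≤ n}
    {S : Set (Eqn n)} {F : (Fin p → ℕ) → Fin n → ℕ} (hF : Parametrizes hpn S F) :
    ∃ (m : ℕ) (hpm : p ≤ m) (T : Set (Eqn m)) (G : (Fin p → ℕ) → Fin m → ℕ),
      Parametrizes hpm T G ∧ (∀ i, ∃ j, ∀ x, G x j = F x i) ∧
        (∃ k, ∀ x, G x k = f x) ∧ ∃ l, ∀ x, G x l = g x := by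
  obtain ⟨m, hpm, T, G, hG, hFG, k, hk⟩ := hf n hpn S F hF
  obtain ⟨r, hpr, U, H, hH, hGH, l, hl⟩ := hg m hpm T G hG
  refine ⟨r, hpr, U, H, hH, fun i => ?_, ?_, l, hl⟩
  · obtain ⟨j, hj⟩ := hFG i
    obtain ⟨j', hj'⟩ := hGH j
    exact ⟨j', fun x => (hj' x).trans (hj x)⟩
  · obtain ⟨k', hk'⟩ := hGH k
    exact ⟨k', fun x => (hk' x).trans (hk x)⟩

/-- Functions obtained from two expressible ones by a single equation are expressible. -/
theorem binary (op : ℕ → ℕ → ℕ) (hf : Expressible f) (hg : Expressible g)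
    (hop : ∀ (n : ℕ) (k l : Fin n), ∃ e : Eqn (n + 1), ∀ (v : Fin n → ℕ) (a : ℕ),
      e.holds (Fin.snoc v a : Fin (n + 1) → ℕ) ↔ a = op (v k) (v l)) :
    Expressible fun x => op (f x) (g x) := by
  intro n hpn S F hF
  obtain ⟨m, hpm, T, G, hG, hFG, ⟨k, hk⟩, l, hl⟩ := hf.exists_pair hg hF
  obtain ⟨e, he⟩ := hop m k l
  refine ⟨_, _, _, _, hG.snoc (fun x => op (f x) (g x)) e fun x a => ?_, fun i => ?_,
    Fin.last m, fun x => by simp⟩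
  · rw [he, hk, hl]
  · obtain ⟨j, hj⟩ := hFG i
    exact ⟨j.castSucc, fun x => by simp [hj]⟩

theorem add (hf : Expressible f) (hg : Expressible g) : Expressible fun x => f x + g x :=
  hf.binary (· + ·) hg fun n k l => ⟨.add k.castSucc l.castSucc (Fin.last n), fun v a => by
    simp [Eqn.holds, eq_comm]⟩

theorem mul (hf : Expressible f) (hg : Expressible g) : Expressible fun x => f x * g x :=
  hf.binary (· * ·) hg fun n k l => ⟨.mul k.castSucc l.castSucc (Fin.last n), fun v a => by
    simp [Eqn.holds, eq_comm]⟩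

theorem const (c : ℕ) : Expressible fun _ : Fin p → ℕ => c := by
  induction c with
  | zero => exact zero
  | succ c ih => exact ih.add one

/-- On `ℕ`, an integer polynomial is a difference of two expressible functions. -/
theorem exists_eval_eq_sub (D : MvPolynomial (Fin p) ℤ) :
    ∃ f g : (Fin p → ℕ) → ℕ, Expressible f ∧ Expressible g ∧
      ∀ x : Fin p → ℕ, MvPolynomial.eval (fun i => (x i : ℤ)) D = f x - g x := by
  induction D using MvPolynomial.induction_on with
  | C a =>
    refine ⟨_, _, const a.toNat, const (-a).toNat, fun x => ?_⟩
    rw [MvPolynomial.eval_C]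
    omega
  | add P Q hP hQ =>
    obtain ⟨f, g, hf, hg, hfg⟩ := hP
    obtain ⟨f', g', hf', hg', hfg'⟩ := hQ
    refine ⟨_, _, hf.add hf', hg.add hg', fun x => ?_⟩
    rw [map_add, hfg, hfg']
    push_cast
    ring
  | mul_X P i hP =>
    obtain ⟨f, g, hf, hg, hfg⟩ := hP
    refine ⟨_, _, hf.mul (proj i), hg.mul (proj i), fun x => ?_⟩
    rw [map_mul, hfg, MvPolynomial.eval_X]
    push_cast
    ring

end Expressible

/-- The equation `f x = g x` between expressible functions is equivalent to a system whose
remaining variables are functions of `x`. -/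
theorem Expressible.exists_system {p : ℕ} {f g : (Fin p → ℕ) → ℕ} (hf : Expressible f)
    (hg : Expressible g) :
    ∃ (n : ℕ) (hpn : p ≤ n) (S : Set (Eqn n)) (F : (Fin p → ℕ) → Fin n → ℕ),
      (∀ x i, F x (Fin.castLE hpn i) = x i) ∧
        ∀ v, (∀ e ∈ S, e.holds v) ↔ ∃ x, f x = g x ∧ F x = v := by
  have hid : Parametrizes (le_refl p) ∅ (fun x : Fin p → ℕ => x) := ⟨fun _ _ => rfl, by simp⟩
  obtain ⟨m, hpm, T, G, hG, -, z, hz⟩ := zero (p := p) p le_rfl ∅ _ hid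
  obtain ⟨n, hpn, S, F, hF, hGF, ⟨k, hk⟩, l, hl⟩ := hf.exists_pair hg hG
  obtain ⟨z', hz'⟩ := hGF z
  refine ⟨n, hpn, insert (.add k z' l) S, F, hF.1, fun v => ?_⟩
  rw [Set.forall_mem_insert, hF.2]
  constructor
  · rintro ⟨hv, x, rfl⟩
    exact ⟨x, by simpa [Eqn.holds, hk, hl, hz', hz] using hv, rfl⟩
  · rintro ⟨x, hx, rfl⟩
    exact ⟨by simpa [Eqn.holds, hk, hl, hz', hz] using hx, x, rfl⟩

/-- For every nonzero integer polynomial `D` in `p` variables there are `n ≥ p` and a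
system `S ⊆ E_n` such that solvability of `D = 0` at a tuple of non-negative integers
is equivalent to extendability of the tuple to a solution of `S`, the extension is
unique when it exists, and the solution sets of `D = 0` (in `ℕ^p`) and of `S`
(in `ℕ^n`) are equinumerous. -/
theorem equation_to_system (p : ℕ) (D : MvPolynomial (Fin p) ℤ) (hD : D ≠ 0) :
    ∃ n : ℕ, ∃ hpn : p ≤ n, ∃ S : Set (Eqn n),
      (∀ x : Fin p → ℕ,
        MvPolynomial.eval (fun i => (x i : ℤ)) D = 0 ↔
          ∃ v : Fin n → ℕ, (∀ i : Fin p, v (Fin.castLE hpn i) = x i) ∧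
            ∀ e ∈ S, e.holds v) ∧
      (∀ x : Fin p → ℕ,
        MvPolynomial.eval (fun i => (x i : ℤ)) D = 0 →
          ∃! v : Fin n → ℕ, (∀ i : Fin p, v (Fin.castLE hpn i) = x i) ∧
            ∀ e ∈ S, e.holds v) ∧
      Nonempty
        ({x : Fin p → ℕ // MvPolynomial.eval (fun i => (x i : ℤ)) D = 0} ≃
         {v : Fin n → ℕ // ∀ e ∈ S, e.holds v}) := by
  obtain ⟨f, g, hf, hg, hfg⟩ := Expressible.exists_eval_eq_sub D
  obtain ⟨n, hpn, S, F, hF, hS⟩ := hf.exists_system hg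
  have hzero (x : Fin p → ℕ) : MvPolynomial.eval (fun i => (x i : ℤ)) D = 0 ↔ f x = g x := by
    rw [hfg, sub_eq_zero, Nat.cast_inj]
  have hsol (x : Fin p → ℕ) (v : Fin n → ℕ) :
      ((∀ i : Fin p, v (Fin.castLE hpn i) = x i) ∧ ∀ e ∈ S, e.holds v) ↔
        f x = g x ∧ v = F x := by
    rw [hS]
    constructor
    · rintro ⟨hv, y, hy, rfl⟩
      obtain rfl : y = x := funext fun i => (hF y i).symm.trans (hv i)
      exact ⟨hy, rfl⟩
    · rintro ⟨hx, rfl⟩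
      exact ⟨hF x, x, hx, rfl⟩
  refine ⟨n, hpn, S, fun x => ?_, fun x hx => ?_, ⟨?_⟩⟩
  · simp only [hzero, hsol, exists_and_left, exists_eq, and_true]
  · exact ⟨F x, (hsol x _).2 ⟨(hzero x).1 hx, rfl⟩, fun v hv => ((hsol x v).1 hv).2⟩
  · refine Equiv.ofBijective
      (fun x => ⟨F x.1, (hS _).2 ⟨x.1, (hzero x.1).1 x.2, rfl⟩⟩) ⟨fun x y hxy => ?_, fun v => ?_⟩
    · refine Subtype.ext (funext fun i => ?_)
      rw [← hF x.1 i, ← hF y.1 i]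
      exact congrFun (congrArg Subtype.val hxy) _
    · obtain ⟨x, hx, hv⟩ := (hS v.1).1 v.2
      exact ⟨⟨x, (hzero x).2 hx⟩, Subtype.ext hv⟩
end

section
/- For each integer n ≥ 2 and each integer m ≥ 3 + 2·⌊log₂(n−1)⌋, there exists a system U ⊆ { x_i = 1, x_i + x_j = x_k : i, j, k ∈ {1,…,m} } which has exactly n solutions in non-negative integers x_1,…,x_m. -/
/-- An equation of the form `x_i = 1` or `x_i + x_j = x_k`
with indices in `{1,…,m}` (here `Fin m`). -/
inductive LinEqn (m : ℕ) : Type where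
  | one (i : Fin m) : LinEqn m
  | add (i j k : Fin m) : LinEqn m

/-- A valuation `x : Fin m → R` satisfies such an equation. -/
def LinEqn.holds {R : Type*} [Semiring R] {m : ℕ} (x : Fin m → R) : LinEqn m → Prop
  | .one i => x i = 1
  | .add i j k => x i + x j = x k

/-- Every term of `v` is `1` or the sum of two earlier terms. -/
def IsAdditionChain (v : ℕ → ℕ) : Prop :=
  ∀ i, v i = 1 ∨ ∃ j < i, ∃ l < i, v i = v j + v l

/-- The binary method: `N` occurs in an addition chain at a position at most `2 ⌊log₂ N⌋`. -/
theorem exists_isAdditionChain (N : ℕ) (hN : 1 ≤ N) :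
    ∃ v : ℕ → ℕ, IsAdditionChain v ∧ v 0 = 1 ∧ ∃ p ≤ 2 * Nat.log 2 N, v p = N := by
  induction N using Nat.strong_induction_on with
  | _ N ih =>
    rcases Nat.lt_or_ge N 2 with h | h
    · exact ⟨fun _ => 1, fun _ => Or.inl rfl, rfl, 0, Nat.zero_le _, le_antisymm hN (Nat.le_of_lt_succ h)⟩
    · obtain ⟨v, hv, hv0, p, hp, hvp⟩ := ih (N / 2) (by omega) (by omega)
      have hlog : Nat.log 2 N = Nat.log 2 (N / 2) + 1 := Nat.log_of_one_lt_of_le (by norm_num) h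
      let w : ℕ → ℕ := fun i =>
        if i ≤ p then v i else if i = p + 1 then 2 * v p
        else if i = p + 2 then 2 * v p + 1 else 1
      have hw : ∀ i ≤ p, w i = v i := fun i hi => if_pos hi
      have hw1 : w (p + 1) = 2 * v p := by simp [w]
      have hw2 : w (p + 2) = 2 * v p + 1 := by simp [w]
      have hw3 : ∀ i, p + 2 < i → w i = 1 := fun i hi => by
        simp only [w]
        rw [if_neg (by omega), if_neg (by omega), if_neg (by omega)]
      refine ⟨w, fun i => ?_, by rw [hw 0 (Nat.zero_le _), hv0], p + 1 + N % 2, by omega, ?_⟩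
      · rcases (by omega : i ≤ p ∨ i = p + 1 ∨ i = p + 2 ∨ p + 2 < i) with hi | rfl | rfl | hi
        · rw [hw i hi]
          refine (hv i).imp_right ?_
          rintro ⟨j, hj, l, hl, e⟩
          exact ⟨j, hj, l, hl, by rw [hw j (by omega), hw l (by omega), e]⟩
        · exact Or.inr ⟨p, by omega, p, by omega, by rw [hw1, hw p le_rfl, two_mul]⟩
        · exact Or.inr ⟨p + 1, by omega, 0, by omega, by
            rw [hw2, hw1, hw 0 (Nat.zero_le _), hv0]⟩
        · exact Or.inl (hw3 i hi)
      · rcases Nat.mod_two_eq_zero_or_one N with h2 | h2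
        · rw [h2, Nat.add_zero, hw1]
          omega
        · rw [h2, hw2]
          omega

/-- For each `n ≥ 2` and each `m ≥ 3 + 2·⌊log₂(n-1)⌋` there is a system
`U ⊆ {x_i = 1, x_i + x_j = x_k : i,j,k ∈ {1,…,m}}` with exactly `n` solutions
in non-negative integers `x_1,…,x_m`. -/
theorem linear_system_with_n_solutions (n m : ℕ) (hn : 2 ≤ n)
    (hm : 3 + 2 * Nat.log 2 (n - 1) ≤ m) :
    ∃ U : Set (LinEqn m),
      {x : Fin m → ℕ | ∀ e ∈ U, e.holds x}.Finite ∧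
      {x : Fin m → ℕ | ∀ e ∈ U, e.holds x}.ncard = n := by
  obtain ⟨v, hv, -, p, hp, hvp⟩ := exists_isAdditionChain (n - 1) (by omega)
  obtain ⟨k, rfl⟩ : ∃ k, m = k + 2 := ⟨m - 2, by omega⟩
  -- The solutions list the chain, followed by two numbers whose sum is `n - 1`.
  let s : ℕ → Fin (k + 2) → ℕ := fun a i =>
    if i.val < k then v i else if i.val = k then a else n - 1 - a
  have hs : ∀ a (i : Fin (k + 2)), i.val < k → s a i = v i := fun a i hi => if_pos hi
  have hs0 : ∀ a, s a ⟨k, by omega⟩ = a := fun a => by simp [s]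
  have hs1 : ∀ a, s a ⟨k + 1, by omega⟩ = n - 1 - a := fun a => by simp [s]
  let U : Set (LinEqn (k + 2)) := {e | ∀ a < n, e.holds (s a)}
  have hsol : {x : Fin (k + 2) → ℕ | ∀ e ∈ U, e.holds x} = Set.image s (Set.Iio n) := by
    ext x
    simp only [Set.mem_ofPred_eq, Set.mem_image, Set.mem_Iio]
    constructor
    · intro hx
      have hchain : ∀ i (hi : i < k), x ⟨i, by omega⟩ = v i := by
        intro i
        induction i using Nat.strong_induction_on with
        | _ i ih =>
          intro hi
          rcases hv i with h1 | ⟨j, hj, l, hl, e⟩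
          · have hone : x ⟨i, by omega⟩ = 1 := hx (.one ⟨i, by omega⟩) fun a _ => by
              simp only [LinEqn.holds]
              rw [hs a _ hi, h1]
            rw [hone, h1]
          · have hadd : x ⟨j, by omega⟩ + x ⟨l, by omega⟩ = x ⟨i, by omega⟩ :=
              hx (.add ⟨j, by omega⟩ ⟨l, by omega⟩ ⟨i, by omega⟩) fun a _ => by
                simp only [LinEqn.holds]
                rw [hs a _ (hj.trans hi), hs a _ (hl.trans hi), hs a _ hi, e]
            rw [← hadd, ih j hj (by omega), ih l hl (by omega), e]
      have hsum : x ⟨k, by omega⟩ + x ⟨k + 1, by omega⟩ = x ⟨p, by omega⟩ :=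
        hx (.add ⟨k, by omega⟩ ⟨k + 1, by omega⟩ ⟨p, by omega⟩) fun a ha => by
          simp only [LinEqn.holds]
          rw [hs0, hs1, hs a ⟨p, by omega⟩ (by simp only; omega), hvp]
          omega
      rw [hchain p (by omega), hvp] at hsum
      refine ⟨x ⟨k, by omega⟩, by omega, ?_⟩
      ext ⟨i, hi⟩
      rcases (by omega : i < k ∨ i = k ∨ i = k + 1) with h | rfl | rfl
      · rw [hs _ _ h, hchain i h]
      · rw [hs0]
      · rw [hs1]
        omega
    · rintro ⟨a, ha, rfl⟩ e he
      exact he a ha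
  have hinj : Function.Injective s := fun a b hab => by
    rw [← hs0 a, hab, hs0]
  refine ⟨U, ?_, ?_⟩
  · rw [hsol]
    exact (Set.finite_Iio n).image s
  · rw [hsol, Set.ncard_image_of_injective _ hinj, ← Finset.coe_Iio, Set.ncard_coe_finset,
      Nat.card_Iio]
end

section
/- For each non-negative integer k, the polynomial 1 − 2·P_k(x) has exactly 2^k distinct real roots. -/
/-- The polynomial maps `P_k` defined by `P_0(x) = x` and
`P_{k+1}(x) = 4·P_k(x)·(1 - P_k(x))`. -/
def P : ℕ → ℝ → ℝ
  | 0, x => x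
  | k + 1, x => 4 * P k x * (1 - P k x)

open Polynomial Polynomial.Chebyshev in
theorem one_sub_two_mul_P_eq_eval_T (k : ℕ) (x : ℝ) :
    1 - 2 * P k x = (T ℝ (2 ^ k : ℕ)).eval (1 - 2 * x) := by
  induction k with
  | zero => simp [P]
  | succ k ih =>
    rw [pow_succ', Nat.cast_mul, T_mul, eval_comp, ← ih, Nat.cast_ofNat, T_two]
    simp only [P, eval_sub, eval_mul, eval_pow, eval_X, eval_ofNat, eval_one]
    ring

open Polynomial Polynomial.Chebyshev in
theorem ncard_setOf_eval_T_real_eq_zero (n : ℕ) :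
    {y : ℝ | (T ℝ n).eval y = 0}.ncard = n := by
  have hset : {y : ℝ | (T ℝ n).eval y = 0} = ((T ℝ n).roots.toFinset : Set ℝ) := by
    ext y
    simp [T_ne_zero]
  have hcard : (T ℝ n).roots.card = n := by
    rw [roots_T_real]
    exact (Finset.card_image_of_injOn
      ((Finset.range n).nodup_map_iff_injOn.mp (roots_T_real_nodup n))).trans (Finset.card_range n)
  have hnodup : (T ℝ n).roots.Nodup := by
    rw [roots_T_real]
    exact Finset.nodup _
  rw [hset, Set.ncard_coe_finset, Multiset.toFinset_card_of_nodup hnodup, hcard]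

/-- For each non-negative integer `k`, the polynomial `1 - 2·P_k(x)` has exactly
`2^k` distinct real roots. -/
theorem card_real_roots_one_sub_two_P (k : ℕ) :
    {x : ℝ | 1 - 2 * P k x = 0}.ncard = 2 ^ k := by
  have himage : (fun x : ℝ => 1 - 2 * x) '' {x : ℝ | 1 - 2 * P k x = 0} =
      {y : ℝ | (Polynomial.Chebyshev.T ℝ (2 ^ k : ℕ)).eval y = 0} := by
    ext y
    simp only [one_sub_two_mul_P_eq_eval_T, Set.mem_image, Set.mem_ofPred_eq]
    constructor
    · rintro ⟨x, hx, rfl⟩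
      exact hx
    · intro hy
      have hxy : 1 - 2 * ((1 - y) / 2) = y := by ring
      exact ⟨(1 - y) / 2, by rwa [hxy], hxy⟩
  have hinj : Function.Injective (fun x : ℝ => 1 - 2 * x) := fun a b h => by
    simpa using h
  rw [← Set.ncard_image_of_injective _ hinj, himage, ncard_setOf_eval_T_real_eq_zero]
end

section
/- For each non-negative integer k, the set of real roots of the polynomial 1 − 2·P_k(x) equals { (1 − cos((4i+1)·π / 2^{k+1})) / 2 : i ∈ {0,…,2^k − 1} }; moreover these 2^k numbers are pairwise distinct and all belong to the open interval (0,1). -/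
open Real in
theorem P_one_sub_cos_div_two (k : ℕ) (θ : ℝ) :
    P k ((1 - cos θ) / 2) = (1 - cos (2 ^ k * θ)) / 2 := by
  induction k with
  | zero => simp [P]
  | succ k ih =>
    rw [P, ih, show (2 : ℝ) ^ (k + 1) * θ = 2 * (2 ^ k * θ) by ring, cos_two_mul]
    ring

theorem mem_Icc_of_P_mem_Icc {k : ℕ} {x : ℝ} (h : P k x ∈ Set.Icc (0 : ℝ) 1) :
    x ∈ Set.Icc (0 : ℝ) 1 := by
  induction k with
  | zero => exact h
  | succ k ih =>
    have h0 : 0 ≤ 4 * P k x * (1 - P k x) := h.1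
    exact ih ⟨by nlinarith, by nlinarith⟩

theorem sin_ne_zero_of_odd_mul_pi_div (k i : ℕ) :
    Real.sin ((4 * (i : ℝ) + 1) * Real.pi / 2 ^ (k + 1)) ≠ 0 := by
  rw [Ne, Real.sin_eq_zero_iff]
  rintro ⟨n, hn⟩
  rw [eq_div_iff (by positivity)] at hn
  have hreal : (n : ℝ) * 2 ^ (k + 1) = 4 * i + 1 :=
    mul_right_cancel₀ Real.pi_ne_zero (by linarith)
  have hint : n * 2 ^ (k + 1) = 4 * (i : ℤ) + 1 := by exact_mod_cast hreal
  rw [pow_succ, ← mul_assoc] at hint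
  omega

theorem injOn_cos_root_angle (k : ℕ) :
    Set.InjOn (fun i : ℕ => Real.cos ((4 * (i : ℝ) + 1) * Real.pi / 2 ^ (k + 1)))
      (Set.Iio (2 ^ k)) := by
  intro i hi j hj hij
  rw [Set.mem_Iio] at hi hj
  have hpi := Real.pi_ne_zero
  obtain ⟨n, hn | hn⟩ := Real.cos_eq_cos_iff.mp hij
  · have hreal : (4 * j + 1 : ℝ) = 4 * (n * 2 ^ k) + (4 * i + 1) := by
      field_simp at hn
      rw [pow_succ] at hn
      linarith
    have hint : (4 * j + 1 : ℤ) = 4 * (n * 2 ^ k) + (4 * i + 1) := by exact_mod_cast hreal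
    have hdiff : (j : ℤ) - i = n * 2 ^ k := by linarith
    have habs : |(j : ℤ) - i| < 2 ^ k := by
      have hi' : (i : ℤ) < 2 ^ k := by exact_mod_cast hi
      have hj' : (j : ℤ) < 2 ^ k := by exact_mod_cast hj
      rw [abs_lt]
      constructor <;> omega
    have := Int.eq_zero_of_abs_lt_dvd (Dvd.intro_left n hdiff.symm) habs
    omega
  · have hreal : (4 * j + 1 : ℝ) = 4 * (n * 2 ^ k) - (4 * i + 1) := by
      field_simp at hn
      rw [pow_succ] at hn
      linarith
    have hint : (4 * j + 1 : ℤ) = 4 * (n * 2 ^ k) - (4 * i + 1) := by exact_mod_cast hreal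
    omega

theorem exists_cos_root_angle_eq {k : ℕ} {θ : ℝ} (h0 : 0 ≤ θ) (hpi : θ ≤ Real.pi)
    (hcos : Real.cos (2 ^ k * θ) = 0) :
    ∃ i : ℕ, i < 2 ^ k ∧ Real.cos ((4 * (i : ℝ) + 1) * Real.pi / 2 ^ (k + 1)) = Real.cos θ := by
  obtain ⟨m, hm⟩ := Real.cos_eq_zero_iff.mp hcos
  have hpos := Real.pi_pos
  have hθ : θ = (2 * m + 1) * Real.pi / 2 ^ (k + 1) := by
    rw [eq_div_iff (by positivity), pow_succ]
    linarith
  have hlow : (0 : ℤ) ≤ 2 * m + 1 := by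
    have : (0 : ℝ) ≤ 2 * m + 1 := by
      refine nonneg_of_mul_nonneg_left (b := Real.pi) ?_ hpos
      have : 0 ≤ 2 ^ k * θ := by positivity
      linarith
    exact_mod_cast this
  have hupp : 2 * m + 1 ≤ (2 : ℤ) * 2 ^ k := by
    have : (2 * m + 1 : ℝ) ≤ 2 * 2 ^ k := by
      refine le_of_mul_le_mul_right ?_ hpos
      have : 2 ^ k * θ ≤ 2 ^ k * Real.pi := by gcongr
      linarith
    exact_mod_cast this
  obtain ⟨r, hr | hr⟩ := Int.even_or_odd' m
  · lift r to ℕ using by omega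
    refine ⟨r, by zify; omega, ?_⟩
    rw [hθ, hr]
    push_cast
    ring_nf
  · obtain ⟨i, hi⟩ := Int.eq_ofNat_of_zero_le (a := 2 ^ k - (r + 1)) (by omega)
    refine ⟨i, by zify; omega, ?_⟩
    have hreal : (i : ℝ) = 2 ^ k - (r + 1) := by exact_mod_cast hi.symm
    rw [← Real.cos_two_pi_sub θ, hθ, hr, hreal]
    congr 1
    push_cast
    field_simp
    ring

/-- The set of real roots of `1 - 2·P_k(x)` is
`{(1 - cos((4i+1)·π / 2^(k+1))) / 2 : i ∈ {0,…,2^k - 1}}`; moreover these `2^k`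
numbers are pairwise distinct and lie in the open interval `(0,1)`. -/
theorem roots_of_one_sub_two_P (k : ℕ) :
    {x : ℝ | 1 - 2 * P k x = 0} =
      (fun i : ℕ => (1 - Real.cos ((4 * (i : ℝ) + 1) * Real.pi / 2 ^ (k + 1))) / 2) ''
        (Set.Iio (2 ^ k)) ∧
    Set.InjOn
      (fun i : ℕ => (1 - Real.cos ((4 * (i : ℝ) + 1) * Real.pi / 2 ^ (k + 1))) / 2)
      (Set.Iio (2 ^ k)) ∧
    ∀ i : ℕ, i < 2 ^ k →
      (1 - Real.cos ((4 * (i : ℝ) + 1) * Real.pi / 2 ^ (k + 1))) / 2 ∈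
        Set.Ioo (0 : ℝ) 1 := by
  refine ⟨?_, ?_, ?_⟩
  · ext x
    simp only [Set.mem_ofPred_eq, Set.mem_image, Set.mem_Iio]
    constructor
    · intro hx
      have hP : P k x = 1 / 2 := by linarith
      obtain ⟨hx0, hx1⟩ := mem_Icc_of_P_mem_Icc (k := k) (x := x) (by rw [hP]; norm_num)
      have hθ : Real.cos (Real.arccos (1 - 2 * x)) = 1 - 2 * x :=
        Real.cos_arccos (by linarith) (by linarith)
      have hxθ : x = (1 - Real.cos (Real.arccos (1 - 2 * x))) / 2 := by rw [hθ]; ring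
      rw [hxθ, P_one_sub_cos_div_two] at hP
      obtain ⟨i, hi, hcos⟩ := exists_cos_root_angle_eq (k := k)
        (Real.arccos_nonneg (1 - 2 * x)) (Real.arccos_le_pi _) (by linarith)
      exact ⟨i, hi, by rw [hcos, ← hxθ]⟩
    · rintro ⟨i, -, rfl⟩
      have hcos : Real.cos (2 ^ k * ((4 * (i : ℝ) + 1) * Real.pi / 2 ^ (k + 1))) = 0 := by
        rw [Real.cos_eq_zero_iff]
        refine ⟨2 * i, ?_⟩
        push_cast
        field_simp
        ring
      rw [P_one_sub_cos_div_two, hcos]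
      norm_num
  · intro i hi j hj hij
    exact injOn_cos_root_angle k hi hj (by dsimp only at hij ⊢; linarith)
  · intro i _
    have hsin := pow_pos (abs_pos.mpr (sin_ne_zero_of_odd_mul_pi_div k i)) 2
    rw [sq_abs] at hsin
    have hsq := Real.sin_sq_add_cos_sq ((4 * (i : ℝ) + 1) * Real.pi / 2 ^ (k + 1))
    constructor <;> nlinarith
end

section
/- For each non-negative integer k, the equation (1 − 2·P_k(x))² + (y − k)² = 0 has exactly 2^k solutions in real numbers (x, y), and each such solution satisfies y = k. -/
/-- Each level in `(0, 1)` splits into two distinct levels in `(0, 1)` under `t ↦ 4t(1 - t)`. -/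
lemma exists_four_mul_mul_one_sub_eq_iff {c : ℝ} (hc : c ∈ Set.Ioo 0 1) :
    ∃ a ∈ Set.Ioo (0 : ℝ) 1, ∃ b ∈ Set.Ioo (0 : ℝ) 1, a ≠ b ∧
      ∀ t : ℝ, 4 * t * (1 - t) = c ↔ t = a ∨ t = b := by
  obtain ⟨h0, h1⟩ := hc
  have hs : √(1 - c) ^ 2 = 1 - c := Real.sq_sqrt (by linarith)
  have hpos : 0 < √(1 - c) := Real.sqrt_pos.2 (by linarith)
  have hlt : √(1 - c) < 1 := by nlinarith
  refine ⟨(1 - √(1 - c)) / 2, ⟨by linarith, by linarith⟩,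
    (1 + √(1 - c)) / 2, ⟨by linarith, by linarith⟩, by linarith, fun t ↦ ?_⟩
  rw [← sub_eq_zero (a := t), ← sub_eq_zero (a := t) (b := (1 + √(1 - c)) / 2), ← mul_eq_zero]
  constructor <;> intro h <;> linarith

lemma ncard_setOf_P_eq (k : ℕ) {c : ℝ} (hc : c ∈ Set.Ioo 0 1) :
    {x : ℝ | P k x = c}.ncard = 2 ^ k := by
  induction k generalizing c with
  | zero => simp [P]
  | succ k ih =>
    obtain ⟨a, ha, b, hb, hab, h⟩ := exists_four_mul_mul_one_sub_eq_iff hc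
    have hfin {d : ℝ} (hd : d ∈ Set.Ioo 0 1) : {x : ℝ | P k x = d}.Finite :=
      Set.finite_of_ncard_pos (by rw [ih hd]; positivity)
    have hunion : {x : ℝ | P (k + 1) x = c} = {x | P k x = a} ∪ {x | P k x = b} :=
      Set.ext fun x ↦ h (P k x)
    have hdisj : Disjoint {x : ℝ | P k x = a} {x | P k x = b} :=
      Set.disjoint_left.2 fun _ hxa hxb ↦ hab (hxa.symm.trans hxb)
    rw [hunion, Set.ncard_union_eq hdisj (hfin ha) (hfin hb), ih ha, ih hb, pow_succ, mul_two]

/-- For each non-negative integer `k`, the equation `(1 - 2·P_k(x))² + (y - k)² = 0`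
has exactly `2^k` real solutions `(x, y)`, and each of them satisfies `y = k`. -/
theorem solutions_of_one_sub_two_P_sq_add_sq (k : ℕ) :
    {p : ℝ × ℝ | (1 - 2 * P k p.1) ^ 2 + (p.2 - k) ^ 2 = 0}.ncard = 2 ^ k ∧
    ∀ p : ℝ × ℝ, (1 - 2 * P k p.1) ^ 2 + (p.2 - k) ^ 2 = 0 → p.2 = k := by
  have hiff (p : ℝ × ℝ) :
      (1 - 2 * P k p.1) ^ 2 + (p.2 - k) ^ 2 = 0 ↔ P k p.1 = 1 / 2 ∧ p.2 = k := by
    rw [add_eq_zero_iff_of_nonneg (sq_nonneg _) (sq_nonneg _), sq_eq_zero_iff, sq_eq_zero_iff,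
      sub_eq_zero (b := (k : ℝ))]
    refine and_congr_left' ⟨fun h ↦ by linarith, fun h ↦ by linarith⟩
  refine ⟨?_, fun p hp ↦ ((hiff p).1 hp).2⟩
  have hset : {p : ℝ × ℝ | (1 - 2 * P k p.1) ^ 2 + (p.2 - k) ^ 2 = 0} =
      {x | P k x = 1 / 2} ×ˢ {(k : ℝ)} := Set.ext hiff
  rw [hset, Set.ncard_prod, Set.ncard_singleton, mul_one,
    ncard_setOf_P_eq k ⟨by norm_num, by norm_num⟩]
end

section
/- Let n be a positive integer with binary expansion n = Σ_{k=0}^{⌊log₂(n)⌋} a_k·2^k where each a_k ∈ {0,1}, and define W_n(x,y) = ∏_{k : a_k = 1} [ (1 − 2·P_k(x))² + (y − k)² ]. Then the equation W_n(x,y) = 0 has exactly n solutions in real numbers (x, y). -/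
/-- The equation `P_k(x) = c` with `0 < c < 1` has exactly `2 ^ k` real solutions. -/
theorem exists_finset_P_eq (k : ℕ) (c : ℝ) (hc0 : 0 < c) (hc1 : c < 1) :
    ∃ F : Finset ℝ, F.card = 2 ^ k ∧ ∀ x, x ∈ F ↔ P k x = c := by
  induction k generalizing c with
  | zero => exact ⟨{c}, by simp [P]⟩
  | succ k ih =>
    set s := √(1 - c)
    have hs2 : s ^ 2 = 1 - c := Real.sq_sqrt (by linarith)
    have hs0 : 0 < s := Real.sqrt_pos.2 (by linarith)
    have hs1 : s < 1 := by nlinarith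
    obtain ⟨A, hA, hA'⟩ := ih ((1 + s) / 2) (by linarith) (by linarith)
    obtain ⟨B, hB, hB'⟩ := ih ((1 - s) / 2) (by linarith) (by linarith)
    have hAB : Disjoint A B := by
      refine Finset.disjoint_left.2 fun x hx hy => ?_
      linarith [(hA' x).1 hx, (hB' x).1 hy]
    refine ⟨A ∪ B, by rw [Finset.card_union_of_disjoint hAB, hA, hB]; ring, fun x => ?_⟩
    rw [Finset.mem_union, hA', hB', P]
    constructor
    · rintro (h | h) <;> rw [h] <;> linarith
    · intro h
      have hmul : (P k x - (1 + s) / 2) * (P k x - (1 - s) / 2) = 0 := by linarith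
      exact (mul_eq_zero.1 hmul).imp sub_eq_zero.1 sub_eq_zero.1

/-- Let `n` be a positive integer with binary expansion
`n = Σ_{k=0}^{⌊log₂ n⌋} a_k·2^k`, `a_k ∈ {0,1}`, and let
`W_n(x,y) = ∏_{k : a_k = 1} ((1 - 2·P_k(x))² + (y - k)²)`.
Then `W_n(x,y) = 0` has exactly `n` real solutions `(x, y)`. -/
theorem solutions_of_W_n (n : ℕ) (hn : 0 < n) (a : ℕ → ℕ)
    (ha : ∀ k, a k = 0 ∨ a k = 1)
    (hsum : n = ∑ k ∈ Finset.range (Nat.log 2 n + 1), a k * 2 ^ k) :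
    {p : ℝ × ℝ |
        ∏ k ∈ (Finset.range (Nat.log 2 n + 1)).filter (fun k => a k = 1),
          ((1 - 2 * P k p.1) ^ 2 + (p.2 - k) ^ 2) = 0}.ncard = n := by
  choose F hcard hF using fun k => exists_finset_P_eq k (1 / 2) (by norm_num) (by norm_num)
  set S := (Finset.range (Nat.log 2 n + 1)).filter (fun k => a k = 1) with hS
  have hset : {p : ℝ × ℝ | ∏ k ∈ S, ((1 - 2 * P k p.1) ^ 2 + (p.2 - k) ^ 2) = 0} =
      ↑(S.biUnion fun k => F k ×ˢ ({(k : ℝ)} : Finset ℝ)) := by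
    ext ⟨x, y⟩
    simp only [Set.mem_ofPred_eq, Finset.prod_eq_zero_iff, Finset.mem_coe, Finset.mem_biUnion,
      Finset.mem_product, Finset.mem_singleton, hF]
    refine exists_congr fun k => and_congr_right fun _ => ?_
    rw [add_eq_zero_iff_of_nonneg (sq_nonneg _) (sq_nonneg _), sq_eq_zero_iff, sq_eq_zero_iff,
      sub_eq_zero (a := y)]
    refine and_congr_left fun _ => ⟨fun h => by linarith, fun h => by linarith⟩
  rw [hset, Set.ncard_coe_finset, Finset.card_biUnion]
  · conv_rhs => rw [hsum]
    simp only [Finset.card_product, Finset.card_singleton, mul_one, hcard]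
    rw [hS, Finset.sum_filter]
    refine Finset.sum_congr rfl fun k _ => ?_
    rcases ha k with h | h <;> simp [h]
  · intro i _ j _ hij
    refine Finset.disjoint_left.2 fun p hp hq => hij ?_
    simp only [Finset.mem_product, Finset.mem_singleton] at hp hq
    exact_mod_cast hp.2.symm.trans hq.2
end

section
/- For each prime number p, the equation 8·(u² + v² + s² + t² + 1) = 8·(p+1) has exactly 8·(p+1) solutions in integers (u, v, s, t); equivalently, the number of tuples (u, v, s, t) ∈ ℤ⁴ with u² + v² + s² + t² = p equals 8·(p+1). -/
open Quaternion Matrix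

theorem exists_quaternion_of_coords {R : Type*} [CommRing R] (r i j k : R) :
    ∃ q : ℍ[R], q.re = r ∧ q.imI = i ∧ q.imJ = j ∧ q.imK = k :=
  ⟨⟨r, i, j, k⟩, rfl, rfl, rfl, rfl⟩

/-- The image of an integral quaternion under the splitting of the quaternion algebra over `K`
determined by a solution of `a ^ 2 + b ^ 2 = -1`. -/
def splitMatrix {K : Type*} [CommRing K] (a b : K) (x : ℍ[ℤ]) : Matrix (Fin 2) (Fin 2) K :=
  !![x.re + a * x.imJ + b * x.imK, x.imI + b * x.imJ - a * x.imK;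
    -x.imI + b * x.imJ - a * x.imK, x.re - a * x.imJ - b * x.imK]

section Split

variable {K : Type*} [CommRing K] {a b : K}

theorem splitMatrix_mul (hab : a ^ 2 + b ^ 2 = -1) (x y : ℍ[ℤ]) :
    splitMatrix a b (x * y) = splitMatrix a b x * splitMatrix a b y := by
  ext i j
  fin_cases i <;> fin_cases j <;> simp [splitMatrix, Matrix.mul_apply, Fin.sum_univ_two]
  · linear_combination (-x.imJ * y.imJ - x.imK * y.imK : K) * hab
  · linear_combination (x.imJ * y.imK - x.imK * y.imJ : K) * hab
  · linear_combination (x.imK * y.imJ - x.imJ * y.imK : K) * hab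
  · linear_combination (-x.imJ * y.imJ - x.imK * y.imK : K) * hab

theorem splitMatrix_sub (x y : ℍ[ℤ]) :
    splitMatrix a b (x - y) = splitMatrix a b x - splitMatrix a b y := by
  ext i j
  fin_cases i <;> fin_cases j <;> simp [splitMatrix] <;> ring

theorem splitMatrix_star (x : ℍ[ℤ]) :
    splitMatrix a b (star x) = (splitMatrix a b x).adjugate := by
  ext i j
  fin_cases i <;> fin_cases j <;> simp [splitMatrix, Matrix.adjugate_fin_two] <;> ring

theorem det_splitMatrix (hab : a ^ 2 + b ^ 2 = -1) (x : ℍ[ℤ]) :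
    (splitMatrix a b x).det = (normSq x : ℤ) := by
  simp [splitMatrix, Matrix.det_fin_two, normSq_def']
  linear_combination (-x.imJ ^ 2 - x.imK ^ 2 : K) * hab

end Split

theorem adjugate_mul_eq_zero_of_vecMul_eq_zero {K : Type*} [Field K] {w : Fin 2 → K} (hw : w ≠ 0)
    {X Y : Matrix (Fin 2) (Fin 2) K} (hX : w ᵥ* X = 0) (hY : w ᵥ* Y = 0) :
    X.adjugate * Y = 0 := by
  have hX0 := congrFun hX 0
  have hX1 := congrFun hX 1
  have hY0 := congrFun hY 0
  have hY1 := congrFun hY 1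
  simp only [Matrix.vecMul, dotProduct, Fin.sum_univ_two, Pi.zero_apply] at hX0 hX1 hY0 hY1
  have key : ∀ s : K, w 0 * s = 0 → w 1 * s = 0 → s = 0 := by
    intro s h0 h1
    by_contra hs
    exact hw (by ext i; fin_cases i <;> simp_all)
  ext i j
  rw [Matrix.adjugate_fin_two]
  fin_cases i <;> fin_cases j <;> simp [Matrix.mul_apply, Fin.sum_univ_two] <;> apply key
  · linear_combination X 1 1 * hY0 - Y 1 0 * hX1
  · linear_combination Y 0 0 * hX1 - X 0 1 * hY0
  · linear_combination X 1 1 * hY1 - Y 1 1 * hX1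
  · linear_combination Y 0 1 * hX1 - X 0 1 * hY1
  · linear_combination Y 1 0 * hX0 - X 1 0 * hY0
  · linear_combination X 0 0 * hY0 - Y 0 0 * hX0
  · linear_combination Y 1 1 * hX0 - X 1 0 * hY1
  · linear_combination X 0 0 * hY1 - Y 0 1 * hX0

section Prime

variable {p : ℕ} {a b : ZMod p}

theorem splitMatrix_natCast_self : splitMatrix a b (p : ℍ[ℤ]) = 0 := by
  ext i j
  fin_cases i <;> fin_cases j <;> simp [splitMatrix]

variable [Fact p.Prime]

theorem exists_eq_natCast_mul_of_splitMatrix_eq_zero (hp : p ≠ 2) (hab : a ^ 2 + b ^ 2 = -1)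
    {x : ℍ[ℤ]} (hx : splitMatrix a b x = 0) : ∃ y : ℍ[ℤ], x = (p : ℍ[ℤ]) * y := by
  have h00 := congrFun₂ hx 0 0
  have h01 := congrFun₂ hx 0 1
  have h10 := congrFun₂ hx 1 0
  have h11 := congrFun₂ hx 1 1
  simp [splitMatrix] at h00 h01 h10 h11
  have h2 : (2 : ZMod p) ≠ 0 := by
    intro h
    have : ((2 : ℕ) : ZMod p) = 0 := by exact_mod_cast h
    rw [ZMod.natCast_eq_zero_iff] at this
    exact hp ((Nat.prime_dvd_prime_iff_eq Fact.out Nat.prime_two).1 this)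
  have hr : (x.re : ZMod p) = 0 :=
    mul_left_cancel₀ h2 (by linear_combination h00 + h11)
  have hi : (x.imI : ZMod p) = 0 :=
    mul_left_cancel₀ h2 (by linear_combination h01 - h10)
  have hj : (x.imJ : ZMod p) = 0 := by
    linear_combination x.imJ * hab - a * (h00 - hr) - b * (h01 - hi)
  have hk : (x.imK : ZMod p) = 0 := by
    linear_combination x.imK * hab - b * (h00 - hr) + a * (h01 - hi)
  rw [ZMod.intCast_zmod_eq_zero_iff_dvd] at hr hi hj hk
  obtain ⟨r, hr⟩ := hr
  obtain ⟨i, hi⟩ := hi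
  obtain ⟨j, hj⟩ := hj
  obtain ⟨k, hk⟩ := hk
  obtain ⟨q, rfl, rfl, rfl, rfl⟩ := exists_quaternion_of_coords r i j k
  exact ⟨q, by ext <;> simp [hr, hi, hj, hk]⟩

theorem dvd_normSq_of_vecMul_splitMatrix_eq_zero (hab : a ^ 2 + b ^ 2 = -1)
    {w : Fin 2 → ZMod p} (hw : w ≠ 0) {x : ℍ[ℤ]} (hx : w ᵥ* splitMatrix a b x = 0) :
    (p : ℤ) ∣ normSq x := by
  rw [← ZMod.intCast_zmod_eq_zero_iff_dvd, ← det_splitMatrix hab]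
  exact Matrix.exists_vecMul_eq_zero_iff.1 ⟨w, hw, hx⟩

end Prime

theorem exists_four_mul_sub_mul_sq_le (x : ℤ) {m : ℤ} (hm : 0 < m) :
    ∃ d : ℤ, 4 * (x - m * d) ^ 2 ≤ m ^ 2 := by
  refine ⟨(2 * x + m) / (2 * m), ?_⟩
  have h1 := Int.emod_add_mul_ediv (2 * x + m) (2 * m)
  have h2 := Int.emod_nonneg (2 * x + m) (show 2 * m ≠ 0 by lia)
  have h3 := Int.emod_lt_of_pos (2 * x + m) (show 0 < 2 * m by lia)
  set d := (2 * x + m) / (2 * m)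
  have h4 : (2 * (x - m * d)) ^ 2 ≤ m ^ 2 := sq_le_sq' (by linarith) (by linarith)
  linarith

theorem exists_two_mul_eq_mul_of_four_mul_sq_eq {r m : ℤ} (h : 4 * r ^ 2 = m ^ 2) :
    ∃ s : ℤ, 2 * r = m * s := by
  rcases sq_eq_sq_iff_eq_or_eq_neg.1 (show (2 * r) ^ 2 = m ^ 2 by linarith) with h | h
  · exact ⟨1, by linarith⟩
  · exact ⟨-1, by linarith⟩

/-- Rounding the coordinates of `x / m` gives a remainder of norm at most `m ^ 2`, and the extreme
cases of a zero or maximal remainder only occur if `m ^ 2` divides the norm of `x`. -/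
theorem exists_normSq_sub_mul_lt (x : ℍ[ℤ]) {m : ℤ} (hm : 0 < m) (hx : ¬ m ^ 2 ∣ normSq x) :
    ∃ d : ℍ[ℤ], 0 < normSq (x - (m : ℍ[ℤ]) * d) ∧ normSq (x - (m : ℍ[ℤ]) * d) < m ^ 2 := by
  obtain ⟨d0, h0⟩ := exists_four_mul_sub_mul_sq_le x.re hm
  obtain ⟨d1, h1⟩ := exists_four_mul_sub_mul_sq_le x.imI hm
  obtain ⟨d2, h2⟩ := exists_four_mul_sub_mul_sq_le x.imJ hm
  obtain ⟨d3, h3⟩ := exists_four_mul_sub_mul_sq_le x.imK hm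
  obtain ⟨d, rfl, rfl, rfl, rfl⟩ := exists_quaternion_of_coords d0 d1 d2 d3
  refine ⟨d, ?_, ?_⟩
  · refine lt_of_le_of_ne normSq_nonneg fun h ↦ hx ?_
    have := sub_eq_zero.1 (normSq_eq_zero.1 h.symm)
    rw [this, map_mul, normSq_intCast]
    exact dvd_mul_right _ _
  · by_contra! hle
    simp [normSq_def'] at hle hx
    obtain ⟨s0, e0⟩ := exists_two_mul_eq_mul_of_four_mul_sq_eq (r := x.re - m * d.re) (m := m)
      (by linarith)
    obtain ⟨s1, e1⟩ := exists_two_mul_eq_mul_of_four_mul_sq_eq (r := x.imI - m * d.imI) (m := m)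
      (by linarith)
    obtain ⟨s2, e2⟩ := exists_two_mul_eq_mul_of_four_mul_sq_eq (r := x.imJ - m * d.imJ) (m := m)
      (by linarith)
    obtain ⟨s3, e3⟩ := exists_two_mul_eq_mul_of_four_mul_sq_eq (r := x.imK - m * d.imK) (m := m)
      (by linarith)
    have hr : (x.re - m * d.re) ^ 2 + (x.imI - m * d.imI) ^ 2 + (x.imJ - m * d.imJ) ^ 2 +
        (x.imK - m * d.imK) ^ 2 = m ^ 2 := by linarith
    refine hx ⟨1 + s0 * d.re + s1 * d.imI + s2 * d.imJ + s3 * d.imK +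
      d.re ^ 2 + d.imI ^ 2 + d.imJ ^ 2 + d.imK ^ 2, ?_⟩
    linear_combination hr + m * d.re * e0 + m * d.imI * e1 + m * d.imJ * e2 + m * d.imK * e3

section Lattice

variable {p : ℕ} [Fact p.Prime] {a b : ZMod p} {w : Fin 2 → ZMod p}

theorem exists_normSq_eq_prime_of_lt (hab : a ^ 2 + b ^ 2 = -1) (hw : w ≠ 0) (m : ℕ) :
    0 < m → m < p → (∃ x : ℍ[ℤ], normSq x = m * p ∧ w ᵥ* splitMatrix a b x = 0) →
      ∃ x : ℍ[ℤ], normSq x = p ∧ w ᵥ* splitMatrix a b x = 0 := by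
  have hp : p.Prime := Fact.out
  induction m using Nat.strong_induction_on with
  | _ m ih =>
    rintro hm hmp ⟨x, hx, hxw⟩
    rcases (show 1 ≤ m from hm).eq_or_lt with rfl | hm1
    · exact ⟨x, by simpa using hx, hxw⟩
    have hm0 : (0 : ℤ) < m := by exact_mod_cast hm
    have hp0 : (0 : ℤ) < p := by exact_mod_cast hp.pos
    have hndvd : ¬ (m : ℤ) ^ 2 ∣ normSq (star x) := by
      rw [normSq_star, hx, sq]
      intro h
      have h' : m ∣ p := by exact_mod_cast Int.dvd_of_mul_dvd_mul_left hm0.ne' h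
      rcases (Nat.dvd_prime hp).1 h' with h' | h' <;> lia
    obtain ⟨d, hd0, hd⟩ := exists_normSq_sub_mul_lt (star x) hm0 hndvd
    set y : ℍ[ℤ] := p - x * d with hy
    have hyw : w ᵥ* splitMatrix a b y = 0 := by
      rw [hy, splitMatrix_sub, splitMatrix_natCast_self, splitMatrix_mul hab, zero_sub,
        Matrix.vecMul_neg, ← Matrix.vecMul_vecMul, hxw, Matrix.zero_vecMul, neg_zero]
    obtain ⟨k, hk⟩ := dvd_normSq_of_vecMul_splitMatrix_eq_zero hab hw hyw
    have hxy : star x * y = (p : ℍ[ℤ]) * (star x - ((m : ℤ) : ℍ[ℤ]) * d) := by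
      rw [hy, mul_sub, ← mul_assoc, star_mul_self, hx, mul_sub, ← mul_assoc,
        (Nat.cast_commute p (star x)).eq]
      push_cast
      rw [(Nat.cast_commute p (m : ℍ[ℤ])).eq]
    have hmk : (m : ℤ) * k = normSq (star x - ((m : ℤ) : ℍ[ℤ]) * d) := by
      have h := congrArg normSq hxy
      rw [map_mul, map_mul, normSq_star, hx, hk, normSq_natCast] at h
      refine mul_left_cancel₀ (pow_ne_zero 2 hp0.ne') ?_
      linear_combination h
    have hk0 : 0 < k := by
      rw [← hmk] at hd0
      exact pos_of_mul_pos_right hd0 hm0.le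
    have hkm : k < m := by
      rw [← hmk, sq] at hd
      exact lt_of_mul_lt_mul_left hd hm0.le
    lift k to ℕ using hk0.le
    exact ih k (by exact_mod_cast hkm) (by exact_mod_cast hk0) (by lia)
      ⟨y, by rw [hk, mul_comm], hyw⟩

theorem exists_normSq_eq_prime (hp2 : p ≠ 2) (hab : a ^ 2 + b ^ 2 = -1) (hw : w ≠ 0) :
    ∃ x : ℍ[ℤ], normSq x = p ∧ w ᵥ* splitMatrix a b x = 0 := by
  have hp : p.Prime := Fact.out
  obtain ⟨x, h0, h1, h2, h3⟩ := exists_quaternion_of_coords (w 1).valMinAbs (w 0).valMinAbs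
    (-(a * w 1 - b * w 0)).valMinAbs (-(b * w 1 + a * w 0)).valMinAbs
  have hxw : w ᵥ* splitMatrix a b x = 0 := by
    ext i
    fin_cases i <;>
      simp [splitMatrix, Matrix.vecMul, dotProduct, Fin.sum_univ_two, h0, h1, h2, h3]
    · ring
    · linear_combination (w 0 ^ 2 + w 1 ^ 2) * hab
  have hx : x ≠ 0 := by
    rintro rfl
    refine hw ?_
    ext i
    fin_cases i
    · simpa using h1.symm
    · simpa using h0.symm
  have hpos : 0 < normSq x := lt_of_le_of_ne normSq_nonneg (normSq_ne_zero.2 hx).symm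
  have hbound (z : ZMod p) : 4 * z.valMinAbs ^ 2 < (p : ℤ) ^ 2 := by
    have h := z.natAbs_valMinAbs_le
    have hodd := hp.odd_of_ne_two hp2
    have h' : |2 * z.valMinAbs| < (p : ℤ) := by
      obtain ⟨n, hn⟩ := hodd
      rw [abs_lt]
      lia
    have := sq_lt_sq' (abs_lt.1 h').1 (abs_lt.1 h').2
    linarith
  obtain ⟨m, hm⟩ := dvd_normSq_of_vecMul_splitMatrix_eq_zero hab hw hxw
  have hp0 : (0 : ℤ) < p := by exact_mod_cast hp.pos
  have hm0 : 0 < m := by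
    rw [hm] at hpos
    exact pos_of_mul_pos_right hpos hp0.le
  have hmp : m < p := by
    refine lt_of_mul_lt_mul_left (a := (p : ℤ)) ?_ hp0.le
    rw [← hm, normSq_def', h0, h1, h2, h3]
    linarith [hbound (w 1), hbound (w 0), hbound (-(a * w 1 - b * w 0)),
      hbound (-(b * w 1 + a * w 0))]
  lift m to ℕ using hm0.le
  exact exists_normSq_eq_prime_of_lt hab hw m (by exact_mod_cast hm0) (by exact_mod_cast hmp)
    ⟨x, by rw [hm, mul_comm], hxw⟩

end Lattice

theorem ncard_normSq_eq (n : ℤ) :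
    {x : ℍ[ℤ] | normSq x = n}.ncard =
      {q : ℤ × ℤ × ℤ × ℤ |
        q.1 ^ 2 + q.2.1 ^ 2 + q.2.2.1 ^ 2 + q.2.2.2 ^ 2 = n}.ncard := by
  rw [← Set.ncard_image_of_injective _ (Quaternion.equivProd ℤ).injective]
  congr 1
  ext q
  rw [Equiv.image_eq_preimage_symm]
  simp only [Set.mem_preimage, Set.mem_ofPred_eq, normSq_def']
  rfl

theorem setOf_four_sq_eq_filter {n : ℤ} (B : ℕ) (hn : n < (B + 1) ^ 2) :
    {q : ℤ × ℤ × ℤ × ℤ | q.1 ^ 2 + q.2.1 ^ 2 + q.2.2.1 ^ 2 + q.2.2.2 ^ 2 = n} =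
      ↑{q ∈ Finset.Icc (-B : ℤ) B ×ˢ Finset.Icc (-B : ℤ) B ×ˢ
          Finset.Icc (-B : ℤ) B ×ˢ Finset.Icc (-B : ℤ) B |
        q.1 ^ 2 + q.2.1 ^ 2 + q.2.2.1 ^ 2 + q.2.2.2 ^ 2 = n} := by
  have key (z : ℤ) (hz : z ^ 2 ≤ n) : -(B : ℤ) ≤ z ∧ z ≤ B := by
    have := abs_lt_of_sq_lt_sq (hz.trans_lt hn) (by positivity)
    rw [abs_lt] at this
    lia
  ext ⟨u, v, s, t⟩
  simp only [Set.mem_ofPred_eq, Finset.coe_filter, Finset.mem_product, Finset.mem_Icc]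
  refine ⟨fun h ↦ ⟨⟨key u ?_, key v ?_, key s ?_, key t ?_⟩, h⟩, fun h ↦ h.2⟩ <;>
    linarith [sq_nonneg u, sq_nonneg v, sq_nonneg s, sq_nonneg t]

theorem finite_normSq_eq (n : ℕ) : {x : ℍ[ℤ] | normSq x = n}.Finite := by
  have h : {q : ℤ × ℤ × ℤ × ℤ |
      q.1 ^ 2 + q.2.1 ^ 2 + q.2.2.1 ^ 2 + q.2.2.2 ^ 2 = (n : ℤ)}.Finite := by
    rw [setOf_four_sq_eq_filter n (by nlinarith)]
    exact Finset.finite_toSet _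
  refine Set.Finite.of_finite_image (f := Quaternion.equivProd ℤ) (h.subset ?_)
    (Quaternion.equivProd ℤ).injective.injOn
  rintro _ ⟨x, hx, rfl⟩
  exact (normSq_def' x).symm.trans hx

theorem ncard_normSq_eq_one : {x : ℍ[ℤ] | normSq x = 1}.ncard = 8 := by
  rw [ncard_normSq_eq, setOf_four_sq_eq_filter 1 (by norm_num), Set.ncard_coe_finset]
  decide +kernel

theorem ncard_normSq_eq_two : {x : ℍ[ℤ] | normSq x = 2}.ncard = 24 := by
  rw [ncard_normSq_eq, setOf_four_sq_eq_filter 1 (by norm_num), Set.ncard_coe_finset]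
  decide +kernel

theorem ncard_normSq_eq_prime_and_vecMul_eq_zero {p : ℕ} [Fact p.Prime] (hp2 : p ≠ 2)
    {a b : ZMod p} (hab : a ^ 2 + b ^ 2 = -1) {w : Fin 2 → ZMod p} (hw : w ≠ 0) :
    {x : ℍ[ℤ] | normSq x = p ∧ w ᵥ* splitMatrix a b x = 0}.ncard = 8 := by
  have hp0 : (p : ℤ) ≠ 0 := by exact_mod_cast (Fact.out : p.Prime).ne_zero
  obtain ⟨x, hx, hxw⟩ := exists_normSq_eq_prime hp2 hab hw
  have hx0 : x ≠ 0 := normSq_ne_zero.1 (hx ▸ hp0)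
  rw [← ncard_normSq_eq_one,
    ← Set.ncard_image_of_injective {u : ℍ[ℤ] | normSq u = 1} (mul_right_injective₀ hx0)]
  congr 1
  ext y
  simp only [Set.mem_ofPred_eq, Set.mem_image]
  constructor
  · rintro ⟨hy, hyw⟩
    have h : splitMatrix a b (star x * y) = 0 := by
      rw [splitMatrix_mul hab, splitMatrix_star]
      exact adjugate_mul_eq_zero_of_vecMul_eq_zero hw hxw hyw
    obtain ⟨u, hu⟩ := exists_eq_natCast_mul_of_splitMatrix_eq_zero hp2 hab h
    refine ⟨u, ?_, ?_⟩
    · have h := congrArg normSq hu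
      rw [map_mul, map_mul, normSq_star, hx, hy, normSq_natCast] at h
      refine mul_left_cancel₀ (pow_ne_zero 2 hp0) ?_
      linear_combination -h
    · have h := congrArg (x * ·) hu
      simp only [← mul_assoc, self_mul_star, hx, ← (Nat.cast_commute p x).eq] at h
      rw [mul_assoc] at h
      refine (mul_left_cancel₀ (normSq_ne_zero.1 ?_) h).symm
      rw [normSq_coe]
      exact pow_ne_zero 2 hp0
  · rintro ⟨u, hu, rfl⟩
    refine ⟨by rw [map_mul, hx, hu, mul_one], ?_⟩
    rw [splitMatrix_mul hab, ← Matrix.vecMul_vecMul, hxw, Matrix.zero_vecMul]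

/-- Normalized representatives of the points of the projective line over `K`. -/
def projectiveVector {K : Type*} [Field K] : Option K → Fin 2 → K
  | none => ![0, 1]
  | some t => ![1, t]

theorem projectiveVector_ne_zero {K : Type*} [Field K] (t : Option K) :
    projectiveVector t ≠ 0 := by
  cases t with
  | none => exact fun h ↦ one_ne_zero (congrFun h 1)
  | some t => exact fun h ↦ one_ne_zero (congrFun h 0)

theorem existsUnique_projectiveVector_vecMul_eq_zero {K : Type*} [Field K]
    {X : Matrix (Fin 2) (Fin 2) K} (hdet : X.det = 0) (hX : X ≠ 0) :
    ∃! t : Option K, projectiveVector t ᵥ* X = 0 := by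
  have hnone : projectiveVector none ᵥ* X = 0 ↔ X 1 0 = 0 ∧ X 1 1 = 0 := by
    simp [projectiveVector, funext_iff, Fin.forall_fin_two, Matrix.vecMul, dotProduct,
      Fin.sum_univ_two]
  have hsome (t : K) : projectiveVector (some t) ᵥ* X = 0 ↔
      X 0 0 + t * X 1 0 = 0 ∧ X 0 1 + t * X 1 1 = 0 := by
    simp [projectiveVector, funext_iff, Fin.forall_fin_two, Matrix.vecMul, dotProduct,
      Fin.sum_univ_two]
  rw [Matrix.det_fin_two] at hdet
  by_cases h : X 1 0 = 0 ∧ X 1 1 = 0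
  · refine ⟨none, hnone.2 h, ?_⟩
    rintro (_ | t) ht
    · rfl
    · refine absurd ?_ hX
      have := (hsome t).1 ht
      ext i j
      fin_cases i <;> fin_cases j <;> simp_all
  · obtain ⟨t, ht⟩ : ∃ t : K, X 0 0 + t * X 1 0 = 0 ∧ X 0 1 + t * X 1 1 = 0 := by
      by_cases h0 : X 1 0 = 0
      · have h1 : X 1 1 ≠ 0 := fun h1 ↦ h ⟨h0, h1⟩
        refine ⟨-X 0 1 / X 1 1, ?_, ?_⟩
        · field_simp
          linear_combination hdet
        · field_simp
          ring
      · refine ⟨-X 0 0 / X 1 0, ?_, ?_⟩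
        · field_simp
          ring
        · field_simp
          linear_combination -hdet
    refine ⟨some t, (hsome t).2 ht, ?_⟩
    rintro (_ | s) hs
    · exact absurd (hnone.1 hs) h
    · have hs := (hsome s).1 hs
      by_contra hne
      have hst : s - t ≠ 0 := sub_ne_zero.2 fun e ↦ hne (by rw [e])
      refine h ⟨mul_left_cancel₀ hst ?_, mul_left_cancel₀ hst ?_⟩
      · linear_combination hs.1 - ht.1
      · linear_combination hs.2 - ht.2

theorem ncard_normSq_eq_prime_of_ne_two {p : ℕ} [Fact p.Prime] (hp2 : p ≠ 2) :
    {x : ℍ[ℤ] | normSq x = p}.ncard = 8 * (p + 1) := by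
  classical
  have hp : p.Prime := Fact.out
  obtain ⟨a, b, hab⟩ := ZMod.sq_add_sq p (-1)
  have hfin := finite_normSq_eq p
  rw [Set.ncard_eq_toFinset_card _ hfin]
  have h := Finset.card_mul_eq_card_mul (s := hfin.toFinset)
    (t := (Finset.univ : Finset (Option (ZMod p)))) (m := 1) (n := 8)
    (fun x t ↦ projectiveVector t ᵥ* splitMatrix a b x = 0) ?_ ?_
  · rw [mul_one, Finset.card_univ, Fintype.card_option, ZMod.card] at h
    rw [h, mul_comm]
  · intro x hx
    have hx : normSq x = p := by simpa using hx
    have hdet : (splitMatrix a b x).det = 0 := by simp [det_splitMatrix hab, hx]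
    have hne : splitMatrix a b x ≠ 0 := by
      intro h0
      obtain ⟨y, rfl⟩ := exists_eq_natCast_mul_of_splitMatrix_eq_zero hp2 hab h0
      rw [map_mul, normSq_natCast] at hx
      have hdvd : (p : ℤ) * p ∣ p * 1 := ⟨normSq y, by linear_combination -hx⟩
      have hp0 : (p : ℤ) ≠ 0 := by exact_mod_cast hp.ne_zero
      have : p ∣ 1 := by exact_mod_cast Int.dvd_of_mul_dvd_mul_left hp0 hdvd
      exact hp.not_dvd_one this
    obtain ⟨t, ht, huniq⟩ := existsUnique_projectiveVector_vecMul_eq_zero hdet hne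
    refine Finset.card_eq_one.2 ⟨t, ?_⟩
    ext s
    simp only [Finset.mem_bipartiteAbove, Finset.mem_univ, true_and, Finset.mem_singleton]
    exact ⟨huniq s, fun e ↦ e ▸ ht⟩
  · intro t _
    rw [← ncard_normSq_eq_prime_and_vecMul_eq_zero hp2 hab (projectiveVector_ne_zero t),
      ← Set.ncard_coe_finset]
    congr 1
    ext x
    simp

/-- For each prime `p`, the equation `8·(u² + v² + s² + t² + 1) = 8·(p+1)` has exactly
`8·(p+1)` integer solutions `(u, v, s, t)`; equivalently, the number of quadruples of
integers with `u² + v² + s² + t² = p` equals `8·(p+1)`. -/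
theorem card_four_square_representations_of_prime (p : ℕ) (hp : p.Prime) :
    {q : ℤ × ℤ × ℤ × ℤ |
        8 * (q.1 ^ 2 + q.2.1 ^ 2 + q.2.2.1 ^ 2 + q.2.2.2 ^ 2 + 1) =
          8 * ((p : ℤ) + 1)}.ncard = 8 * (p + 1) ∧
    {q : ℤ × ℤ × ℤ × ℤ |
        q.1 ^ 2 + q.2.1 ^ 2 + q.2.2.1 ^ 2 + q.2.2.2 ^ 2 = (p : ℤ)}.ncard =
      8 * (p + 1) := by
  have hcard : {q : ℤ × ℤ × ℤ × ℤ |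
      q.1 ^ 2 + q.2.1 ^ 2 + q.2.2.1 ^ 2 + q.2.2.2 ^ 2 = (p : ℤ)}.ncard = 8 * (p + 1) := by
    rw [← ncard_normSq_eq]
    rcases eq_or_ne p 2 with rfl | hp2
    · exact ncard_normSq_eq_two
    · have : Fact p.Prime := ⟨hp⟩
      exact ncard_normSq_eq_prime_of_ne_two hp2
  refine ⟨?_, hcard⟩
  rw [← hcard]
  congr 1
  ext q
  simp only [Set.mem_ofPred_eq]
  lia
end

section
/- For each positive integer n, the equation (2x+1)² + (2y)² = 5^{2n−1} has exactly n solutions in non-negative integers (x, y). -/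
/-- For `m ≥ 1`, some representation `5 ^ m = a ^ 2 + b ^ 2` with `a` odd and `b` even has `a` prime
to `5`. It comes from multiplying a representation of `5 ^ (m - 1)` by `1 + 2i` or `1 - 2i`. -/
lemma exists_primitive_sq_add_sq_eq_five_pow (m : ℕ) :
    ∃ a b : ℤ, Odd a ∧ Even b ∧ ¬ 5 ∣ a ∧ a ^ 2 + b ^ 2 = 5 ^ (m + 1) := by
  induction m with
  | zero => exact ⟨1, 2, by decide, by decide, by decide, by norm_num⟩
  | succ m ih =>
    obtain ⟨a, b, ha, hb, h5, h⟩ := ih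
    by_cases hd : (5 : ℤ) ∣ a - 2 * b
    · exact ⟨a + 2 * b, b - 2 * a, by grind, by grind, by omega,
        by rw [pow_succ 5, ← h]; ring⟩
    · exact ⟨a - 2 * b, 2 * a + b, by grind, by grind, hd, by rw [pow_succ 5, ← h]; ring⟩

lemma exists_nat_primitive_solution (m : ℕ) :
    ∃ q : ℕ × ℕ, (2 * q.1 + 1) ^ 2 + (2 * q.2) ^ 2 = 5 ^ (m + 1) ∧ ¬ 5 ∣ 2 * q.1 + 1 := by
  obtain ⟨a, b, ha, hb, h5, h⟩ := exists_primitive_sq_add_sq_eq_five_pow m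
  obtain ⟨x, hx⟩ := Int.natAbs_odd.mpr ha
  obtain ⟨y, hy⟩ := even_iff_exists_two_mul.mp (Int.natAbs_even.mpr hb)
  refine ⟨(x, y), ?_, by dsimp only; omega⟩
  dsimp only
  rw [← hx, ← hy]
  zify
  simpa only [sq_abs] using h

/-- Two representations `N = a ^ 2 + b ^ 2 = c ^ 2 + d ^ 2` of an odd `N` with `b`, `d` even and
`N ∣ a * d - b * c` have `a ^ 2 = c ^ 2`. -/
lemma sq_eq_sq_of_dvd_cross {N a b c d : ℤ} (hN : Odd N) (hab : a ^ 2 + b ^ 2 = N)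
    (hcd : c ^ 2 + d ^ 2 = N) (hb : Even b) (hd : Even d) (h : N ∣ a * d - b * c) :
    a ^ 2 = c ^ 2 := by
  obtain ⟨k, hk⟩ := h
  have hN0 : N ≠ 0 := by rintro rfl; simp at hN
  have hNN : 0 < N ^ 2 := by positivity
  have hke : Even k := by
    have : Even (N * k) := hk ▸ (hd.mul_left a).sub (hb.mul_right c)
    exact (Int.even_mul.mp this).resolve_left (Int.not_even_iff_odd.mpr hN)
  have hnorm : N ^ 2 * k ^ 2 + (a * c + b * d) ^ 2 = N ^ 2 := by
    calc _ = (N * k) ^ 2 + (a * c + b * d) ^ 2 := by ring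
      _ = (a ^ 2 + b ^ 2) * (c ^ 2 + d ^ 2) := by rw [← hk]; ring
      _ = N ^ 2 := by rw [hab, hcd, sq]
  have hk1 : k ^ 2 ≤ 1 := by nlinarith [sq_nonneg (a * c + b * d)]
  have hk0 : k = 0 := by
    obtain ⟨j, rfl⟩ := hke
    have : j ^ 2 < 1 := by nlinarith
    have : j = 0 := by nlinarith [sq_nonneg j, pow_eq_zero_iff (n := 2) two_ne_zero (a := j)]
    simp [this]
  have hprod : N * (a ^ 2 - c ^ 2) = 0 := by
    calc N * (a ^ 2 - c ^ 2) = a ^ 2 * N - c ^ 2 * N := by ring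
      _ = a ^ 2 * (c ^ 2 + d ^ 2) - c ^ 2 * (a ^ 2 + b ^ 2) := by rw [hab, hcd]
      _ = (a * d - b * c) * (a * d + b * c) := by ring
      _ = 0 := by rw [hk, hk0]; ring
  exact sub_eq_zero.mp ((mul_eq_zero.mp hprod).resolve_left hN0)

/-- A representation `5 ^ m = a ^ 2 + b ^ 2` with `b` even and `a`, `b` prime to `5` is unique
up to signs. -/
lemma sq_eq_sq_of_primitive {m : ℕ} {a b c d : ℤ} (hab : a ^ 2 + b ^ 2 = 5 ^ m)
    (hcd : c ^ 2 + d ^ 2 = 5 ^ m) (hb : Even b) (hd : Even d) (ha5 : ¬ 5 ∣ a) (hd5 : ¬ 5 ∣ d) :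
    a ^ 2 = c ^ 2 := by
  have h5 : Prime (5 : ℤ) := by norm_num
  have hodd : Odd ((5 : ℤ) ^ m) := Odd.pow (by decide)
  have hdvd : (5 : ℤ) ^ m ∣ (a * d - b * c) * (a * d + b * c) := by
    refine ⟨a ^ 2 - c ^ 2, ?_⟩
    calc (a * d - b * c) * (a * d + b * c)
        = a ^ 2 * (c ^ 2 + d ^ 2) - c ^ 2 * (a ^ 2 + b ^ 2) := by ring
      _ = 5 ^ m * (a ^ 2 - c ^ 2) := by rw [hab, hcd]; ring
  have had : ¬ (5 : ℤ) ∣ a * d := fun h => (h5.dvd_or_dvd h).elim ha5 hd5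
  by_cases h : (5 : ℤ) ∣ a * d + b * c
  · have h' : ¬ (5 : ℤ) ∣ a * d - b * c := by omega
    exact sq_eq_sq_of_dvd_cross (b := -b) hodd (by simpa using hab) hcd hb.neg hd
      (by simpa using h5.pow_dvd_of_dvd_mul_left m h' hdvd)
  · exact sq_eq_sq_of_dvd_cross hodd hab hcd hb hd (h5.pow_dvd_of_dvd_mul_right m h hdvd)

lemma five_dvd_iff_of_sq_add_sq {m a b : ℕ} (h : a ^ 2 + b ^ 2 = 5 ^ (m + 1)) :
    5 ∣ a ↔ 5 ∣ b := by
  have h5 : Nat.Prime 5 := by norm_num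
  have hs : 5 ∣ a ^ 2 + b ^ 2 := h ▸ dvd_pow_self 5 m.succ_ne_zero
  rw [← h5.prime.dvd_pow_iff_dvd two_ne_zero, ← h5.prime.dvd_pow_iff_dvd (a := b) two_ne_zero]
  exact ⟨fun h => (Nat.dvd_add_right h).mp hs, fun h => (Nat.dvd_add_left h).mp hs⟩

lemma nat_primitive_solution_unique {m : ℕ} {p q : ℕ × ℕ}
    (hp : (2 * p.1 + 1) ^ 2 + (2 * p.2) ^ 2 = 5 ^ (m + 1)) (hp5 : ¬ 5 ∣ 2 * p.1 + 1)
    (hq : (2 * q.1 + 1) ^ 2 + (2 * q.2) ^ 2 = 5 ^ (m + 1)) (hq5 : ¬ 5 ∣ 2 * q.1 + 1) :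
    p = q := by
  have hq5' : ¬ 5 ∣ 2 * q.2 := mt (five_dvd_iff_of_sq_add_sq hq).mpr hq5
  have key : (2 * p.1 + 1 : ℤ) ^ 2 = (2 * q.1 + 1) ^ 2 :=
    sq_eq_sq_of_primitive (b := 2 * p.2) (d := 2 * q.2) (by exact_mod_cast hp)
      (by exact_mod_cast hq) (even_two_mul _) (even_two_mul _) (by omega) (by omega)
  have key' : (2 * p.1 + 1) ^ 2 = (2 * q.1 + 1) ^ 2 := by exact_mod_cast key
  have h1 := Nat.pow_left_injective two_ne_zero key'
  have h2 := Nat.pow_left_injective (n := 2) two_ne_zero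
    (show (2 * p.2) ^ 2 = (2 * q.2) ^ 2 by omega)
  ext <;> grind

/-- The solutions for `5 ^ (m + 2)` are one primitive solution and the solutions for `5 ^ m`
scaled by `5`. -/
lemma exists_solutions_eq_insert_image (m : ℕ) :
    ∃ q : ℕ × ℕ, ¬ 5 ∣ 2 * q.1 + 1 ∧
      {p : ℕ × ℕ | (2 * p.1 + 1) ^ 2 + (2 * p.2) ^ 2 = 5 ^ (m + 2)} =
        insert q ((fun p : ℕ × ℕ => (5 * p.1 + 2, 5 * p.2)) ''
          {p : ℕ × ℕ | (2 * p.1 + 1) ^ 2 + (2 * p.2) ^ 2 = 5 ^ m}) := by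
  obtain ⟨q, hq, hq5⟩ := exists_nat_primitive_solution (m + 1)
  refine ⟨q, hq5, Set.ext fun p => ⟨fun hp => ?_, ?_⟩⟩
  · by_cases hp5 : 5 ∣ 2 * p.1 + 1
    · right
      have hp5' := (five_dvd_iff_of_sq_add_sq hp).mp hp5
      obtain ⟨x, y⟩ := p
      obtain ⟨x, rfl⟩ : ∃ z, x = 5 * z + 2 := ⟨x / 5, by dsimp only at hp5; omega⟩
      obtain ⟨y, rfl⟩ : ∃ z, y = 5 * z := ⟨y / 5, by dsimp only at hp5'; omega⟩
      refine ⟨(x, y), ?_, rfl⟩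
      simp only [Set.mem_ofPred_eq, pow_add] at hp ⊢
      linarith
    · exact Or.inl (nat_primitive_solution_unique hp hp5 hq hq5)
  · rintro (rfl | ⟨p, hp, rfl⟩)
    · exact hq
    · simp only [Set.mem_ofPred_eq, pow_add (5 : ℕ) m 2] at hp ⊢
      rw [← hp]
      ring

lemma encard_nonneg_solutions (n : ℕ) :
    {q : ℕ × ℕ | (2 * q.1 + 1) ^ 2 + (2 * q.2) ^ 2 = 5 ^ (2 * n + 1)}.encard = n + 1 := by
  induction n with
  | zero =>
    suffices {q : ℕ × ℕ | (2 * q.1 + 1) ^ 2 + (2 * q.2) ^ 2 = 5 ^ (2 * 0 + 1)} = {(0, 1)} by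
      rw [this]; simp
    ext ⟨x, y⟩
    simp only [Set.mem_ofPred_eq, Set.mem_singleton_iff, Prod.mk.injEq]
    refine ⟨fun h => ?_, by rintro ⟨rfl, rfl⟩; rfl⟩
    norm_num at h
    have hx : x < 1 := by nlinarith
    have hy : y < 2 := by nlinarith
    interval_cases x; interval_cases y <;> simp_all
  | succ n ih =>
    obtain ⟨q, hq5, hq⟩ := exists_solutions_eq_insert_image (2 * n + 1)
    have hinj : Function.Injective fun p : ℕ × ℕ => (5 * p.1 + 2, 5 * p.2) := by
      rintro ⟨x, y⟩ ⟨z, w⟩ h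
      simpa using h
    rw [show 2 * (n + 1) + 1 = 2 * n + 1 + 2 by ring, hq, Set.encard_insert_of_notMem,
      hinj.encard_image, ih]
    · norm_cast
    · rintro ⟨p, -, rfl⟩
      dsimp only at hq5
      omega

/-- For each positive integer `n`, the equation `(2x+1)² + (2y)² = 5^(2n-1)` has
exactly `n` solutions in non-negative integers `(x, y)`. -/
theorem card_nonneg_solutions_sum_two_squares (n : ℕ) (hn : 0 < n) :
    {q : ℕ × ℕ | (2 * q.1 + 1) ^ 2 + (2 * q.2) ^ 2 = 5 ^ (2 * n - 1)}.ncard = n := by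
  obtain ⟨n, rfl⟩ := Nat.exists_eq_add_of_le' hn
  rw [show 2 * (n + 1) - 1 = 2 * n + 1 by omega, Set.ncard_def, encard_nonneg_solutions]
  norm_cast
end
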